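/- arXiv:1208.0911 — 3 statements merged into one kernel-verified Lean document; each statement's English description precedes it below -/
import Mathlib

section
/- For every integer d ≥ 1 and all f₁,…,f_d ∈ F_α, there exists a probability measure μ on ℝ^d whose characteristic function satisfies, for all (θ₁,…,θ_d) ∈ ℝ^d, ∫_{ℝ^d} exp(i⟨θ,x⟩) dμ(x) = exp(−∫_ℝ |∑_{l=1}^d θ_l f_l(x)|^{α(x)} dx). (These are the finite-dimensional distributions of the α(x)-multistable stochastic integral.) -/
open MeasureTheory
open Filter Topology RealInnerProductSpace

section RealCharFun

variable {E : Type*} [NormedAddCommGroup E] [InnerProductSpace ℝ E] [MeasurableSpace E]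

/-- A real function is the characteristic function of some probability measure. -/
def IsRealCharFun (φ : E → ℝ) : Prop :=
  ∃ μ : Measure E, IsProbabilityMeasure μ ∧ ∀ t, charFun μ t = (φ t : ℂ)

variable [BorelSpace E]

lemma IsRealCharFun.one : IsRealCharFun (fun _ : E => (1 : ℝ)) :=
  ⟨Measure.dirac 0, inferInstance, fun t => by simp [charFun_dirac]⟩

/-- A pointwise limit of characteristic functions which is continuous at `0` is a
characteristic function. -/
lemma IsRealCharFun.of_tendsto [FiniteDimensional ℝ E] {φ : ℕ → E → ℝ} {ψ : E → ℝ}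
    (hφ : ∀ᶠ n in atTop, IsRealCharFun (φ n)) (hψ : ContinuousAt ψ 0)
    (h : ∀ t, Tendsto (fun n => φ n t) atTop (𝓝 (ψ t))) : IsRealCharFun ψ := by
  obtain ⟨N, hN⟩ := eventually_atTop.1 hφ
  choose μ hμ hμφ using fun n : ℕ => hN (n + N) (by omega)
  have hlim (t : E) : Tendsto (fun n => charFun (μ n) t) atTop (𝓝 (ψ t : ℂ)) := by
    simp_rw [hμφ]
    exact (Complex.continuous_ofReal.tendsto _).comp ((tendsto_add_atTop_iff_nat N).2 (h t))
  have htight : IsTightMeasureSet (Set.range μ) :=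
    isTightMeasureSet_of_tendsto_charFun (f := fun t => (ψ t : ℂ))
      (Complex.continuous_ofReal.continuousAt.comp hψ) hlim
  let P : ℕ → ProbabilityMeasure E := fun n => ⟨μ n, hμ n⟩
  have hcomp : IsCompact (closure (Set.range P)) := by
    refine isCompact_closure_of_isTightMeasureSet (htight.subset ?_)
    rintro _ ⟨_, ⟨n, rfl⟩, rfl⟩
    exact ⟨n, rfl⟩
  let U : Ultrafilter ℕ := Ultrafilter.of atTop
  obtain ⟨ν, -, hν⟩ := hcomp.ultrafilter_le_nhds (U.map P)
    (.trans (by simp) (monotone_principal subset_closure))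
  have hν' : Tendsto P U (𝓝 ν) := hν
  rw [ProbabilityMeasure.tendsto_iff_forall_integral_rclike_tendsto ℂ] at hν'
  refine ⟨ν, inferInstance, fun t => ?_⟩
  refine tendsto_nhds_unique ?_ ((hlim t).mono_left (Ultrafilter.of_le atTop))
  simp_rw [charFun_eq_integral_innerProbChar]
  exact hν' (BoundedContinuousFunction.innerProbChar t)

variable [SecondCountableTopology E]

lemma IsRealCharFun.mul {φ ψ : E → ℝ} (hφ : IsRealCharFun φ) (hψ : IsRealCharFun ψ) :
    IsRealCharFun (fun t => φ t * ψ t) := by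
  obtain ⟨μ, hμ, hμφ⟩ := hφ
  obtain ⟨ν, hν, hνψ⟩ := hψ
  exact ⟨μ.conv ν, inferInstance, fun t => by rw [charFun_conv, hμφ, hνψ]; push_cast; rfl⟩

lemma IsRealCharFun.pow {φ : E → ℝ} (hφ : IsRealCharFun φ) (n : ℕ) :
    IsRealCharFun (fun t => φ t ^ n) := by
  induction n with
  | zero => simpa using IsRealCharFun.one
  | succ n ih => simpa [pow_succ] using ih.mul hφ

variable {X : Type*} [MeasurableSpace X]

lemma integrable_one_sub_cos_inner (ν : Measure X) [IsFiniteMeasure ν] {h : X → E}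
    (hh : Measurable h) (t : E) : Integrable (fun x => 1 - Real.cos ⟪h x, t⟫) ν := by
  refine Integrable.of_bound (C := 2) (Measurable.aestronglyMeasurable (by fun_prop)) ?_
  refine .of_forall fun x => ?_
  rw [Real.norm_eq_abs, abs_le]
  constructor <;> linarith [Real.cos_le_one ⟪h x, t⟫, Real.neg_one_le_cos ⟪h x, t⟫]

lemma IsRealCharFun.one_sub_integral (ν : Measure X) (hν : ν Set.univ ≤ 1) {h : X → E}
    (hh : Measurable h) :
    IsRealCharFun (fun t => 1 - ∫ x, (1 - Real.cos ⟪h x, t⟫) ∂ν) := by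
  have : IsFiniteMeasure ν := ⟨hν.trans_lt (by simp)⟩
  let c : NNReal := 1 / 2
  let ρ : Measure E := (1 - ν Set.univ) • Measure.dirac 0 +
    (c • ν.map h + c • ν.map (fun x => -h x))
  have hfin : (1 - ν Set.univ) ≠ ⊤ := by simp
  have hc : (c : ENNReal) + c = 1 := by
    rw [← ENNReal.coe_add, ENNReal.coe_eq_one]; norm_num [c]
  have hd : IsFiniteMeasure ((1 - ν Set.univ) • Measure.dirac (0 : E)) :=
    ⟨by simpa using hfin.lt_top⟩
  have hm : Measurable (fun x => -h x) := hh.neg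
  refine ⟨ρ, ⟨?_⟩, fun t => ?_⟩
  · simp only [ρ, Measure.add_apply, Measure.smul_apply, Measure.map_apply hh .univ,
      Measure.map_apply hm .univ, Set.preimage_univ, measure_univ, smul_eq_mul, mul_one,
      ENNReal.smul_def]
    rw [← add_mul, hc, one_mul, tsub_add_cancel_of_le hν]
  · have hint (m : Measure E) [IsFiniteMeasure m] :
        Integrable (fun x => Complex.exp (⟪x, t⟫ * Complex.I)) m :=
      (BoundedContinuousFunction.innerProbChar t).integrable m
    have hint' (g : X → E) (hg : Measurable g) :
        Integrable (fun x => Complex.exp (⟪g x, t⟫ * Complex.I)) ν := by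
      have := hint (ν.map g)
      rwa [integrable_map_measure (by fun_prop) hg.aemeasurable] at this
    rw [charFun_apply, integral_add_measure (hint _) (hint _),
      integral_add_measure (hint _) (hint _), integral_smul_measure, integral_dirac,
      integral_smul_nnreal_measure, integral_smul_nnreal_measure,
      integral_map hh.aemeasurable (by fun_prop), integral_map hm.aemeasurable (by fun_prop),
      ← smul_add, ← integral_add (hint' h hh) (hint' _ hm)]
    have hcos : Integrable (fun x => Real.cos ⟪h x, t⟫) ν := by
      refine ((integrable_const (1 : ℝ)).sub (integrable_one_sub_cos_inner ν hh t)).congr ?_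
      exact .of_forall fun x => by simp
    beta_reduce
    rw [integral_sub (integrable_const _) hcos]
    · have : ∀ x, Complex.exp (⟪h x, t⟫ * Complex.I) + Complex.exp (⟪-h x, t⟫ * Complex.I)
          = ((2 * Real.cos ⟪h x, t⟫ : ℝ) : ℂ) := fun x => by
        rw [inner_neg_left]; push_cast; rw [Complex.two_cos]
      simp_rw [this]
      rw [integral_complex_ofReal, integral_const_mul]
      have e : (1 - ν Set.univ).toReal = 1 - ν.real Set.univ := by
        rw [ENNReal.toReal_sub_of_le hν (by simp)]; rfl
      rw [e]
      simp [c, NNReal.smul_def]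
      ring

lemma IsRealCharFun.exp_neg_integral_of_isFiniteMeasure [FiniteDimensional ℝ E] (ν : Measure X)
    [IsFiniteMeasure ν] {h : X → E} (hh : Measurable h) :
    IsRealCharFun (fun t => Real.exp (-∫ x, (1 - Real.cos ⟪h x, t⟫) ∂ν)) := by
  have key (t : E) := Real.tendsto_one_add_div_pow_exp (-∫ x, (1 - Real.cos ⟪h x, t⟫) ∂ν)
  refine IsRealCharFun.of_tendsto ?_ ?_ key
  · obtain ⟨N, hN⟩ := exists_nat_ge (ν.real Set.univ)
    filter_upwards [eventually_ge_atTop (N + 1)] with n hn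
    refine IsRealCharFun.pow ?_ n
    have hn0 : (0 : ℝ) < n := by exact_mod_cast (by omega : 0 < n)
    have hNn : (N : ℝ) ≤ n := by exact_mod_cast (by omega : N ≤ n)
    have := IsRealCharFun.one_sub_integral ((n : NNReal)⁻¹ • ν) ?_ hh
    · convert! this using 2 with t
      rw [integral_smul_nnreal_measure, NNReal.smul_def]
      simp
      ring
    · rw [Measure.smul_apply, ENNReal.smul_def, smul_eq_mul,
        ← ENNReal.ofReal_toReal (measure_ne_top ν Set.univ), ← ENNReal.ofReal_coe_nnreal,
        ← ENNReal.ofReal_mul (by positivity)]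
      refine ENNReal.ofReal_le_one.2 ?_
      change _ * ν.real Set.univ ≤ 1
      push_cast
      rw [inv_mul_le_iff₀ hn0]; linarith
  · refine Real.continuous_exp.continuousAt.comp (ContinuousAt.neg ?_)
    refine continuousAt_of_dominated (bound := fun _ => 2)
      (.of_forall fun t => Measurable.aestronglyMeasurable (by fun_prop))
      (.of_forall fun t => .of_forall fun x => ?_) (integrable_const _)
      (.of_forall fun x => by fun_prop)
    rw [Real.norm_eq_abs, abs_le]
    constructor <;> linarith [Real.cos_le_one ⟪h x, t⟫, Real.neg_one_le_cos ⟪h x, t⟫]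

/-- The Lévy–Khintchine exponent `∫ (1 - cos ⟪h x, t⟫) ∂ν`, for a `σ`-finite measure `ν`. -/
lemma IsRealCharFun.exp_neg_integral [FiniteDimensional ℝ E] (ν : Measure X)
    [SigmaFinite ν] {h : X → E} (hh : Measurable h)
    (hi : ∀ t, Integrable (fun x => 1 - Real.cos ⟪h x, t⟫) ν)
    (hc : ContinuousAt (fun t => ∫ x, (1 - Real.cos ⟪h x, t⟫) ∂ν) 0) :
    IsRealCharFun (fun t => Real.exp (-∫ x, (1 - Real.cos ⟪h x, t⟫) ∂ν)) := by
  refine IsRealCharFun.of_tendsto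
    (φ := fun n t => Real.exp (-∫ x in spanningSets ν n, (1 - Real.cos ⟪h x, t⟫) ∂ν))
    (.of_forall fun n => ?_) (Real.continuous_exp.continuousAt.comp hc.neg) fun t => ?_
  · have : IsFiniteMeasure (ν.restrict (spanningSets ν n)) :=
      ⟨by simpa using measure_spanningSets_lt_top ν n⟩
    exact exp_neg_integral_of_isFiniteMeasure _ hh
  · refine (Real.continuous_exp.tendsto _).comp (Tendsto.neg ?_)
    have := tendsto_setIntegral_of_monotone (measurableSet_spanningSets ν)
      (monotone_spanningSets ν) (f := fun x => 1 - Real.cos ⟪h x, t⟫) (hi t).integrableOn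
    simpa [iUnion_spanningSets] using this

end RealCharFun
lemma measurable_one_sub_cos_mul_rpow (β : ℝ) :
    Measurable (fun r : ℝ => (1 - Real.cos r) * r ^ (-1 - β)) := by fun_prop

lemma integrableOn_one_sub_cos_mul_rpow {β : ℝ} (h0 : 0 < β) (h2 : β < 2) :
    IntegrableOn (fun r : ℝ => (1 - Real.cos r) * r ^ (-1 - β)) (Set.Ioi 0) := by
  rw [← Set.Ioc_union_Ioi_eq_Ioi (zero_le_one (α := ℝ))]
  refine IntegrableOn.union ?_ ?_
  · have hr : IntegrableOn (fun r : ℝ => r ^ (1 - β)) (Set.Ioc 0 1) :=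
      (intervalIntegrable_iff_integrableOn_Ioc_of_le zero_le_one).1
        (intervalIntegral.intervalIntegrable_rpow' (by linarith))
    refine hr.mono' (measurable_one_sub_cos_mul_rpow β).aestronglyMeasurable ?_
    refine (ae_restrict_iff' measurableSet_Ioc).2 (.of_forall fun r hr => ?_)
    have hp : 0 < r ^ (-1 - β) := Real.rpow_pos_of_pos hr.1 _
    rw [Real.norm_eq_abs, abs_of_nonneg (mul_nonneg (by linarith [Real.cos_le_one r]) hp.le),
      show 1 - β = 2 + (-1 - β) by ring, Real.rpow_add hr.1]
    gcongr
    have := Real.one_sub_sq_div_two_le_cos (x := r)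
    rw [Real.rpow_two]
    nlinarith [sq_nonneg r]
  · have hr : IntegrableOn (fun r : ℝ => 2 * r ^ (-1 - β)) (Set.Ioi 1) :=
      (integrableOn_Ioi_rpow_of_lt (by linarith) one_pos).const_mul 2
    refine hr.mono' (measurable_one_sub_cos_mul_rpow β).aestronglyMeasurable ?_
    refine (ae_restrict_iff' measurableSet_Ioi).2 (.of_forall fun r hr => ?_)
    have hp : 0 < r ^ (-1 - β) := Real.rpow_pos_of_pos (zero_lt_one.trans hr) _
    rw [Real.norm_eq_abs, abs_of_nonneg (mul_nonneg (by linarith [Real.cos_le_one r]) hp.le)]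
    gcongr
    linarith [Real.neg_one_le_cos r]

/-- The constant `c` in `∫ r > 0, (1 - cos (u * r)) * r ^ (-1 - β) = |u| ^ β * c`. -/
noncomputable def stableConst (β : ℝ) : ℝ :=
  ∫ r in Set.Ioi (0 : ℝ), (1 - Real.cos r) * r ^ (-1 - β)

lemma measurable_stableConst : Measurable stableConst := by
  refine StronglyMeasurable.measurable ?_
  exact StronglyMeasurable.integral_prod_right
    (f := fun β r : ℝ => (1 - Real.cos r) * r ^ (-1 - β))
    (Measurable.stronglyMeasurable (by unfold Function.uncurry; fun_prop))

lemma stableConst_pos {β : ℝ} (h0 : 0 < β) (h2 : β < 2) : 0 < stableConst β := by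
  unfold stableConst
  rw [setIntegral_pos_iff_support_of_nonneg_ae _ (integrableOn_one_sub_cos_mul_rpow h0 h2)]
  · refine lt_of_lt_of_le (b := volume (Set.Ioo (0 : ℝ) 1)) (by simp) (measure_mono ?_)
    intro r hr
    refine ⟨?_, hr.1⟩
    have hcos : Real.cos r < 1 := by
      rw [← Real.cos_zero]
      exact Real.cos_lt_cos_of_nonneg_of_le_pi le_rfl
        (by linarith [hr.2, Real.pi_gt_three]) hr.1
    exact mul_ne_zero (by linarith) (Real.rpow_pos_of_pos hr.1 _).ne'
  · refine (ae_restrict_iff' measurableSet_Ioi).2 (.of_forall fun r hr => ?_)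
    exact mul_nonneg (by linarith [Real.cos_le_one r]) (Real.rpow_pos_of_pos hr _).le

lemma one_sub_cos_mul_mul_rpow_eq {β u r : ℝ} (hu : u ≠ 0) (hr : 0 < r) :
    (1 - Real.cos (u * r)) * r ^ (-1 - β) =
      |u| ^ (1 + β) * ((1 - Real.cos (|u| * r)) * (|u| * r) ^ (-1 - β)) := by
  have hu' : 0 < |u| := abs_pos.2 hu
  have hcos : Real.cos (|u| * r) = Real.cos (u * r) := by
    rw [← abs_of_pos hr, ← abs_mul, Real.cos_abs, abs_of_pos hr]
  rw [hcos, Real.mul_rpow hu'.le hr.le, show -1 - β = -(1 + β) by ring, Real.rpow_neg hu'.le]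
  have := (Real.rpow_pos_of_pos hu' (1 + β)).ne'
  field_simp

lemma integrableOn_one_sub_cos_mul_mul_rpow {β : ℝ} (h0 : 0 < β) (h2 : β < 2) (u : ℝ) :
    IntegrableOn (fun r : ℝ => (1 - Real.cos (u * r)) * r ^ (-1 - β)) (Set.Ioi 0) := by
  rcases eq_or_ne u 0 with rfl | hu
  · simp
  · refine (integrableOn_congr_fun (fun r (hr : r ∈ Set.Ioi 0) =>
      one_sub_cos_mul_mul_rpow_eq hu hr) measurableSet_Ioi).2 ?_
    refine Integrable.const_mul ?_ _
    refine (integrableOn_Ioi_comp_mul_left_iff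
      (fun r : ℝ => (1 - Real.cos r) * r ^ (-1 - β)) 0 (abs_pos.2 hu)).2 ?_
    simpa using integrableOn_one_sub_cos_mul_rpow h0 h2

lemma integral_one_sub_cos_mul_mul_rpow {β : ℝ} (h0 : 0 < β) (u : ℝ) :
    ∫ r in Set.Ioi (0 : ℝ), (1 - Real.cos (u * r)) * r ^ (-1 - β) = |u| ^ β * stableConst β := by
  rcases eq_or_ne u 0 with rfl | hu
  · simp [Real.zero_rpow h0.ne']
  · have hu' := abs_pos.2 hu
    rw [setIntegral_congr_fun measurableSet_Ioi
      (fun r hr => one_sub_cos_mul_mul_rpow_eq (β := β) hu hr), integral_const_mul,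
      integral_comp_mul_left_Ioi (fun r : ℝ => (1 - Real.cos r) * r ^ (-1 - β)) 0 hu',
      mul_zero, ← stableConst, Real.rpow_add hu', Real.rpow_one, smul_eq_mul]
    field_simp

section Stable

variable {E : Type*} [NormedAddCommGroup E] [InnerProductSpace ℝ E]

lemma abs_inner_rpow_le {β : ℝ} (h0 : 0 < β) (h2 : β ≤ 2) (v t : E) :
    |⟪v, t⟫| ^ β ≤ max 1 ‖t‖ ^ 2 * ‖v‖ ^ β := by
  have h1 : |⟪v, t⟫| ≤ max 1 ‖t‖ * ‖v‖ := by
    refine (abs_real_inner_le_norm v t).trans ?_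
    rw [mul_comm]
    gcongr
    exact le_max_right _ _
  have hM : (1 : ℝ) ≤ max 1 ‖t‖ := le_max_left _ _
  calc |⟪v, t⟫| ^ β ≤ (max 1 ‖t‖ * ‖v‖) ^ β := by gcongr
    _ = max 1 ‖t‖ ^ β * ‖v‖ ^ β := Real.mul_rpow (by linarith) (norm_nonneg _)
    _ ≤ max 1 ‖t‖ ^ 2 * ‖v‖ ^ β := by
      gcongr
      rw [← Real.rpow_two]
      exact Real.rpow_le_rpow_of_exponent_le hM h2

variable [MeasurableSpace E] [BorelSpace E] [SecondCountableTopology E]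
  {X : Type*} [MeasurableSpace X] {m : Measure X} {α : X → ℝ} {h : X → E}

lemma integrable_abs_inner_rpow (hαm : Measurable α) (hα : ∀ᵐ x ∂m, 0 < α x ∧ α x ≤ 2)
    (hh : Measurable h) (hi : Integrable (fun x => ‖h x‖ ^ α x) m) (t : E) :
    Integrable (fun x => |⟪h x, t⟫| ^ α x) m := by
  refine (hi.const_mul (max 1 ‖t‖ ^ 2)).mono' (Measurable.aestronglyMeasurable ?_) ?_
  · fun_prop
  · filter_upwards [hα] with x hx
    rw [Real.norm_eq_abs, abs_of_nonneg (by positivity)]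
    exact abs_inner_rpow_le hx.1 hx.2 _ _

lemma continuousAt_integral_abs_inner_rpow (hαm : Measurable α)
    (hα : ∀ᵐ x ∂m, 0 < α x ∧ α x ≤ 2) (hh : Measurable h)
    (hi : Integrable (fun x => ‖h x‖ ^ α x) m) :
    ContinuousAt (fun t => ∫ x, |⟪h x, t⟫| ^ α x ∂m) 0 := by
  refine continuousAt_of_dominated (bound := fun x => ‖h x‖ ^ α x)
    (.of_forall fun t => (integrable_abs_inner_rpow hαm hα hh hi t).aestronglyMeasurable) ?_ hi ?_
  · filter_upwards [Metric.closedBall_mem_nhds (0 : E) one_pos] with t ht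
    filter_upwards [hα] with x hx
    rw [Real.norm_eq_abs, abs_of_nonneg (by positivity)]
    have := abs_inner_rpow_le hx.1 hx.2 (h x) t
    rwa [max_eq_left (by simpa using ht), one_pow, one_mul] at this
  · filter_upwards [hα] with x hx
    have : Continuous (fun t : E => |⟪h x, t⟫| ^ α x) :=
      Continuous.rpow_const (by fun_prop) fun t => Or.inr hx.1.le
    exact this.continuousAt

variable [FiniteDimensional ℝ E] [SigmaFinite m]

lemma IsRealCharFun.exp_neg_integral_abs_inner_rpow_of_lt_two (hαm : Measurable α)
    (hα : ∀ᵐ x ∂m, 0 < α x ∧ α x < 2) (hh : Measurable h)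
    (hi : Integrable (fun x => ‖h x‖ ^ α x) m) :
    IsRealCharFun (fun t => Real.exp (-∫ x, |⟪h x, t⟫| ^ α x ∂m)) := by
  have hα' : ∀ᵐ x ∂m, 0 < α x ∧ α x ≤ 2 := hα.mono fun x hx => ⟨hx.1, hx.2.le⟩
  let P : Measure (X × ℝ) := m.prod (volume.restrict (Set.Ioi 0))
  let w : X × ℝ → NNReal := fun p => ((stableConst (α p.1))⁻¹ * p.2 ^ (-1 - α p.1)).toNNReal
  have hw : Measurable w := by
    have := measurable_stableConst
    fun_prop
  let H : X × ℝ → E := fun p => p.2 • h p.1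
  have hH : Measurable H := by fun_prop
  let F : E → X × ℝ → ℝ := fun t p => w p • (1 - Real.cos ⟪H p, t⟫)
  have hFm (t : E) : Measurable (F t) := by fun_prop
  have hF0 (t : E) (p : X × ℝ) : 0 ≤ F t p := by
    have := Real.cos_le_one ⟪H p, t⟫
    exact smul_nonneg (zero_le) (by linarith)
  have hFeq (t : E) {x : X} (hx : 0 < α x ∧ α x < 2) : ∀ r ∈ Set.Ioi (0 : ℝ),
      F t (x, r) = (stableConst (α x))⁻¹ *
        ((1 - Real.cos (⟪h x, t⟫ * r)) * r ^ (-1 - α x)) := fun r hr => by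
    have hc := stableConst_pos hx.1 hx.2
    have hp := Real.rpow_pos_of_pos hr (-1 - α x)
    simp only [F, w, H, NNReal.smul_def, smul_eq_mul]
    rw [Real.coe_toNNReal _ (by positivity), real_inner_smul_left, mul_comm r]
    ring
  have hFi (t : E) : ∀ᵐ x ∂m, ∫ r in Set.Ioi (0 : ℝ), F t (x, r) = |⟪h x, t⟫| ^ α x := by
    filter_upwards [hα] with x hx
    rw [setIntegral_congr_fun measurableSet_Ioi (hFeq t hx), integral_const_mul,
      integral_one_sub_cos_mul_mul_rpow hx.1]
    have := (stableConst_pos hx.1 hx.2).ne'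
    field_simp
  have hint (t : E) : Integrable (F t) P := by
    refine (integrable_prod_iff (hFm t).aestronglyMeasurable).2 ⟨?_, ?_⟩
    · filter_upwards [hα] with x hx
      refine (integrableOn_congr_fun (hFeq t hx) measurableSet_Ioi).2 ?_
      exact (integrableOn_one_sub_cos_mul_mul_rpow hx.1 hx.2 _).const_mul _
    · refine (integrable_abs_inner_rpow hαm hα' hh hi t).congr ?_
      filter_upwards [hFi t] with x hx
      simp_rw [Real.norm_eq_abs, abs_of_nonneg (hF0 _ _)]
      exact hx.symm
  have hval (t : E) : ∫ p, (1 - Real.cos ⟪H p, t⟫) ∂(P.withDensity fun p => w p)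
      = ∫ x, |⟪h x, t⟫| ^ α x ∂m := by
    rw [integral_withDensity_eq_integral_smul hw, ← integral_congr_ae (hFi t)]
    exact integral_prod _ (hint t)
  have : SigmaFinite (P.withDensity fun p => (w p : ENNReal)) := SigmaFinite.withDensity w
  have key := IsRealCharFun.exp_neg_integral (P.withDensity fun p => w p) hH
    (fun t => (integrable_withDensity_iff_integrable_smul hw).2 (hint t))
  simp_rw [hval] at key
  exact key (continuousAt_integral_abs_inner_rpow hαm hα' hh hi)

lemma tendsto_two_mul_sq_mul_one_sub_cos (u : ℝ) :
    Tendsto (fun n : ℕ => 2 * ((n : ℝ) + 1) ^ 2 * (1 - Real.cos (u / (n + 1)))) atTop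
      (𝓝 (u ^ 2)) := by
  rw [tendsto_iff_norm_sub_tendsto_zero]
  have hn : Tendsto (fun n : ℕ => 1 / ((n : ℝ) + 1)) atTop (𝓝 0) :=
    tendsto_one_div_add_atTop_nhds_zero_nat
  have hlim : Tendsto (fun n : ℕ => u ^ 4 * (1 / ((n : ℝ) + 1)) ^ 2) atTop (𝓝 0) := by
    simpa using (hn.pow 2).const_mul (u ^ 4)
  have hu : Tendsto (fun n : ℕ => |u / ((n : ℝ) + 1)|) atTop (𝓝 0) := by
    have := (hn.const_mul u).abs
    simpa [div_eq_mul_inv] using this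
  refine squeeze_zero' (.of_forall fun n => norm_nonneg _) ?_ hlim
  filter_upwards [hu.eventually_le_const one_pos] with n hn1
  have hb := Real.cos_bound hn1
  have hpos : (0 : ℝ) < n + 1 := by positivity
  set N : ℝ := n + 1
  have e : 2 * N ^ 2 * (1 - Real.cos (u / N)) - u ^ 2 =
      -(2 * N ^ 2) * (Real.cos (u / N) - (1 - (u / N) ^ 2 / 2)) := by
    field_simp
    ring
  rw [e, norm_mul, norm_neg, Real.norm_eq_abs, Real.norm_eq_abs, abs_of_pos (by positivity)]
  calc 2 * N ^ 2 * |Real.cos (u / N) - (1 - (u / N) ^ 2 / 2)|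
      ≤ 2 * N ^ 2 * (|u / N| ^ 4 * (5 / 96)) := by gcongr
    _ = (10 / 96) * (u ^ 4 * (1 / N) ^ 2) := by
      rw [show |u / N| ^ 4 = (u / N) ^ 4 from (by decide : Even 4).pow_abs _]
      field_simp
      ring
    _ ≤ u ^ 4 * (1 / N) ^ 2 := by
      have : 0 ≤ u ^ 4 * (1 / N) ^ 2 := by positivity
      linarith

lemma IsRealCharFun.exp_neg_integral_inner_sq (hh : Measurable h)
    (hi : Integrable (fun x => ‖h x‖ ^ 2) m) :
    IsRealCharFun (fun t => Real.exp (-∫ x, ⟪h x, t⟫ ^ 2 ∂m)) := by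
  have hsq (n : ℕ) (v t : E) : ‖2 * ((n : ℝ) + 1) ^ 2 * (1 - Real.cos (⟪v, t⟫ / (n + 1)))‖ ≤
      ‖t‖ ^ 2 * ‖v‖ ^ 2 := by
    set N : ℝ := n + 1
    have hpos : 0 < N := by positivity
    rw [Real.norm_eq_abs, abs_of_nonneg
      (mul_nonneg (by positivity) (by linarith [Real.cos_le_one (⟪v, t⟫ / N)]))]
    calc 2 * N ^ 2 * (1 - Real.cos (⟪v, t⟫ / N))
        ≤ 2 * N ^ 2 * ((⟪v, t⟫ / N) ^ 2 / 2) := by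
          gcongr
          linarith [Real.one_sub_sq_div_two_le_cos (x := ⟪v, t⟫ / N)]
      _ = |⟪v, t⟫| ^ 2 := by rw [sq_abs]; field_simp
      _ ≤ (‖v‖ * ‖t‖) ^ 2 := by gcongr; exact abs_real_inner_le_norm v t
      _ = ‖t‖ ^ 2 * ‖v‖ ^ 2 := by ring
  have hm (n : ℕ) (t : E) : AEStronglyMeasurable
      (fun x => 2 * ((n : ℝ) + 1) ^ 2 * (1 - Real.cos (⟪h x, t⟫ / (n + 1)))) m :=
    Measurable.aestronglyMeasurable (by fun_prop)
  have hint (n : ℕ) (t : E) : Integrable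
      (fun x => 2 * ((n : ℝ) + 1) ^ 2 * (1 - Real.cos (⟪h x, t⟫ / (n + 1)))) m :=
    (hi.const_mul (‖t‖ ^ 2)).mono' (hm n t) (.of_forall fun x => hsq n (h x) t)
  refine IsRealCharFun.of_tendsto (φ := fun n t => Real.exp
    (-∫ x, 2 * ((n : ℝ) + 1) ^ 2 * (1 - Real.cos (⟪h x, t⟫ / (n + 1))) ∂m))
    (.of_forall fun n => ?_) ?_ fun t => ?_
  · let c : NNReal := 2 * (n + 1) ^ 2
    have hval (t : E) : ∫ x, (1 - Real.cos ⟪(n + 1 : ℝ)⁻¹ • h x, t⟫) ∂(m.withDensity fun _ => c)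
        = ∫ x, 2 * ((n : ℝ) + 1) ^ 2 * (1 - Real.cos (⟪h x, t⟫ / (n + 1))) ∂m := by
      rw [integral_withDensity_eq_integral_smul measurable_const]
      simp [c, NNReal.smul_def, real_inner_smul_left, div_eq_inv_mul]
    have : SigmaFinite (m.withDensity fun _ => (c : ENNReal)) := SigmaFinite.withDensity _
    have key := IsRealCharFun.exp_neg_integral (m.withDensity fun _ => c)
      (hh.const_smul (n + 1 : ℝ)⁻¹) (fun t => by
        rw [integrable_withDensity_iff_integrable_smul measurable_const]
        refine (hint n t).congr (.of_forall fun x => ?_)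
        simp [c, NNReal.smul_def, real_inner_smul_left, div_eq_inv_mul])
    simp only [Pi.smul_apply] at key
    simp_rw [hval] at key
    refine key (continuousAt_of_dominated (bound := fun x => ‖h x‖ ^ 2)
      (.of_forall fun t => hm n t) ?_ hi (.of_forall fun x => by fun_prop))
    filter_upwards [Metric.closedBall_mem_nhds (0 : E) one_pos] with t ht
    refine .of_forall fun x => (hsq n (h x) t).trans ?_
    have ht' : ‖t‖ ≤ 1 := by simpa using ht
    exact mul_le_of_le_one_left (by positivity) (pow_le_one₀ (norm_nonneg _) ht')
  · refine Real.continuous_exp.continuousAt.comp (ContinuousAt.neg ?_)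
    have := continuousAt_integral_abs_inner_rpow (m := m) (α := fun _ => 2) measurable_const
      (.of_forall fun _ => by norm_num) hh (by simpa using hi)
    simpa using this
  · refine (Real.continuous_exp.tendsto _).comp (Tendsto.neg ?_)
    refine tendsto_integral_of_dominated_convergence (fun x => ‖t‖ ^ 2 * ‖h x‖ ^ 2)
      (fun n => hm n t) (hi.const_mul _) (fun n => .of_forall fun x => hsq n (h x) t)
      (.of_forall fun x => tendsto_two_mul_sq_mul_one_sub_cos _)

/-- The multistable characteristic function `exp (-∫ |⟪h x, t⟫| ^ α x)`. -/
lemma IsRealCharFun.exp_neg_integral_abs_inner_rpow (hαm : Measurable α)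
    (hα : ∀ x, 0 < α x ∧ α x ≤ 2) (hh : Measurable h)
    (hi : Integrable (fun x => ‖h x‖ ^ α x) m) :
    IsRealCharFun (fun t => Real.exp (-∫ x, |⟪h x, t⟫| ^ α x ∂m)) := by
  let A : Set X := {x | α x < 2}
  have hA : MeasurableSet A := measurableSet_lt hαm measurable_const
  have hα2 : ∀ x ∈ Aᶜ, α x = 2 := fun x hx => le_antisymm (hα x).2 (not_lt.1 hx)
  have h1 : IsRealCharFun (fun t => Real.exp (-∫ x in A, |⟪h x, t⟫| ^ α x ∂m)) :=
    exp_neg_integral_abs_inner_rpow_of_lt_two hαm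
      ((ae_restrict_iff' hA).2 (.of_forall fun x hx => ⟨(hα x).1, hx⟩)) hh hi.restrict
  have h2 : IsRealCharFun (fun t => Real.exp (-∫ x in Aᶜ, |⟪h x, t⟫| ^ 2 ∂m)) := by
    simp_rw [sq_abs]
    refine exp_neg_integral_inner_sq hh ?_
    refine (integrableOn_congr_fun (fun x hx => ?_) hA.compl).1 hi.integrableOn
    rw [hα2 x hx, Real.rpow_two]
  convert! h1.mul h2 using 2 with t
  rw [← Real.exp_add, ← neg_add, ← integral_add_compl hA
    (integrable_abs_inner_rpow hαm (.of_forall hα) hh hi t)]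
  congr 3
  refine setIntegral_congr_fun hA.compl fun x hx => ?_
  simp only [hα2 x hx, Real.rpow_two]

end Stable

lemma norm_rpow_le_sum {ι : Type*} [Fintype ι] (v : EuclideanSpace ℝ ι) {β : ℝ} (h0 : 0 < β)
    (h2 : β ≤ 2) : ‖v‖ ^ β ≤ (Fintype.card ι : ℝ) ^ 2 * ∑ i, |v i| ^ β := by
  cases isEmpty_or_nonempty ι
  · have : v = 0 := Subsingleton.elim _ _
    simp [this, h0.ne']
  obtain ⟨j, -, hj⟩ := Finset.exists_max_image Finset.univ (fun i => |v i|) Finset.univ_nonempty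
  have hcard : (1 : ℝ) ≤ Fintype.card ι := by exact_mod_cast Fintype.card_pos
  have hv : ‖v‖ ≤ Fintype.card ι * |v j| := by
    rw [EuclideanSpace.norm_eq, Real.sqrt_le_left (by positivity)]
    calc ∑ i, ‖v i‖ ^ 2 ≤ ∑ _i : ι, |v j| ^ 2 := by
          gcongr with i hi
          exact hj i hi
      _ = Fintype.card ι * |v j| ^ 2 := by simp
      _ ≤ (Fintype.card ι : ℝ) ^ 2 * |v j| ^ 2 := by
          gcongr
          exact le_self_pow₀ hcard two_ne_zero
      _ = (Fintype.card ι * |v j|) ^ 2 := by ring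
  calc ‖v‖ ^ β ≤ (Fintype.card ι * |v j|) ^ β := by gcongr
    _ = (Fintype.card ι : ℝ) ^ β * |v j| ^ β := Real.mul_rpow (by positivity) (abs_nonneg _)
    _ ≤ (Fintype.card ι : ℝ) ^ 2 * ∑ i, |v i| ^ β := by
      gcongr
      · rw [← Real.rpow_two]
        exact Real.rpow_le_rpow_of_exponent_le hcard h2
      · exact Finset.single_le_sum (f := fun i => |v i| ^ β)
          (fun i _ => Real.rpow_nonneg (abs_nonneg _) _) (Finset.mem_univ j)

/-- For every integer d ≥ 1 and all f₁,…,f_d ∈ F_α, there exists a probability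
measure μ on ℝ^d whose characteristic function satisfies, for all θ ∈ ℝ^d,
∫ exp(i⟨θ,x⟩) dμ(x) = exp(−∫_ℝ |∑_l θ_l f_l(x)|^{α(x)} dx). -/
theorem multistable_fdd_exists
    (a : ℝ) (ha : 0 < a)
    (α : ℝ → ℝ) (hαm : Measurable α) (hα : ∀ x, α x ∈ Set.Icc a 2)
    (d : ℕ) (hd : 1 ≤ d)
    (f : Fin d → ℝ → ℝ)
    (hfm : ∀ l, Measurable (f l))
    (hfi : ∀ l, Integrable (fun x => |f l x| ^ α x)) :
    ∃ μ : Measure (Fin d → ℝ), IsProbabilityMeasure μ ∧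
      ∀ θ : Fin d → ℝ,
        (∫ x, Complex.exp (Complex.I * (∑ l, θ l * x l)) ∂μ) =
          (Real.exp (-∫ x : ℝ, |∑ l, θ l * f l x| ^ α x) : ℂ) := by
  have hα' : ∀ x, 0 < α x ∧ α x ≤ 2 := fun x => ⟨ha.trans_le (hα x).1, (hα x).2⟩
  let h : ℝ → EuclideanSpace ℝ (Fin d) := fun x => WithLp.toLp 2 (fun l => f l x)
  have hh : Measurable h := (WithLp.measurable_toLp 2 _).comp (measurable_pi_lambda _ hfm)
  have hi : Integrable (fun x => ‖h x‖ ^ α x) := by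
    refine ((integrable_finsetSum Finset.univ fun l _ => hfi l).const_mul
      ((Fintype.card (Fin d) : ℝ) ^ 2)).mono' (Measurable.aestronglyMeasurable (by fun_prop)) ?_
    refine .of_forall fun x => ?_
    rw [Real.norm_eq_abs, abs_of_nonneg (by positivity)]
    exact norm_rpow_le_sum (h x) (hα' x).1 (hα' x).2
  obtain ⟨μ, hμ, hμt⟩ := IsRealCharFun.exp_neg_integral_abs_inner_rpow hαm hα' hh hi
  have hof : Measurable (WithLp.ofLp : EuclideanSpace ℝ (Fin d) → Fin d → ℝ) :=
    WithLp.measurable_ofLp 2 _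
  refine ⟨μ.map WithLp.ofLp, Measure.isProbabilityMeasure_map hof.aemeasurable, fun θ => ?_⟩
  have := hμt (WithLp.toLp 2 θ)
  rw [charFun_apply] at this
  rw [integral_map hof.aemeasurable (Measurable.aestronglyMeasurable (by fun_prop))]
  simpa [PiLp.inner_apply, h, mul_comm] using this
end

section
/- One has lim_{λ→+∞} sup_{f ∈ S_α} | μ_f({x ∈ ℝ : |x| > λ}) / T_f(λ) − 1 | = 0, where for each f ∈ S_α, μ_f is a probability measure on ℝ whose characteristic function is Φ_f. -/
open MeasureTheory

/-- C(γ) = 2/π if γ = 1 and (1−γ)/(Γ(2−γ)cos(πγ/2)) otherwise. -/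
noncomputable def Cfun (γ : ℝ) : ℝ :=
  if γ = 1 then 2 / Real.pi
  else (1 - γ) / (Real.Gamma (2 - γ) * Real.cos (Real.pi * γ / 2))

/-- T_f(λ) = ∫_ℝ |λ⁻¹ f(x)|^{α(x)} C(α(x)) dx. -/
noncomputable def Tf (α f : ℝ → ℝ) (lam : ℝ) : ℝ :=
  ∫ x : ℝ, |lam⁻¹ * f x| ^ α x * Cfun (α x)

/-- Membership in the unit sphere S_α of F_α: f is measurable, |f|^{α(·)} is integrable,
and ‖f‖_α = 1, i.e. ∫_ℝ |f(x)|^{α(x)} dx = 1. -/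
def MemSα (α f : ℝ → ℝ) : Prop :=
  Measurable f ∧ Integrable (fun x => |f x| ^ α x) ∧ (∫ x : ℝ, |f x| ^ α x) = 1

section TailConstant

open Set

lemma integral_integral_swap_Ioi_of_nonneg {F : ℝ → ℝ → ℝ} {A B : ℝ → ℝ}
    (hF : Measurable (Function.uncurry F)) (hF0 : ∀ x > 0, ∀ t > 0, 0 ≤ F x t)
    (hA : ∀ x > 0, ∫ t in Ioi 0, F x t = A x)
    (hBi : ∀ t > 0, IntegrableOn (fun x => F x t) (Ioi 0))
    (hB : ∀ t > 0, ∫ x in Ioi 0, F x t = B t) (hBint : IntegrableOn B (Ioi 0)) :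
    IntegrableOn A (Ioi 0) ∧ ∫ x in Ioi 0, A x = ∫ t in Ioi 0, B t := by
  have hint : Integrable (Function.uncurry F)
      ((volume.restrict (Ioi 0)).prod (volume.restrict (Ioi 0))) := by
    rw [integrable_prod_iff' hF.aestronglyMeasurable]
    refine ⟨(ae_restrict_iff' measurableSet_Ioi).2 (.of_forall fun t ht => hBi t ht), ?_⟩
    refine hBint.congr ((ae_restrict_iff' measurableSet_Ioi).2 (.of_forall fun t ht => ?_))
    dsimp only
    rw [← hB t ht]
    refine setIntegral_congr_fun measurableSet_Ioi fun x hx => ?_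
    exact (Real.norm_of_nonneg (hF0 x hx t ht)).symm
  have hAe : (fun x => ∫ t in Ioi 0, F x t) =ᵐ[volume.restrict (Ioi 0)] A :=
    (ae_restrict_iff' measurableSet_Ioi).2 (.of_forall fun x hx => hA x hx)
  refine ⟨hint.integral_prod_left.congr hAe, ?_⟩
  rw [← integral_congr_ae hAe, integral_integral_swap hint]
  exact setIntegral_congr_fun measurableSet_Ioi fun t ht => hB t ht

lemma integral_one_sub_cos_mul_exp {t : ℝ} (ht : 0 < t) :
    IntegrableOn (fun x => (1 - Real.cos x) * Real.exp (-(t * x))) (Ioi 0) ∧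
      ∫ x in Ioi 0, (1 - Real.cos x) * Real.exp (-(t * x)) = t⁻¹ * (1 + t ^ 2)⁻¹ := by
  have hre : ((-t + Complex.I : ℂ)).re < 0 := by simpa using ht
  have h1 := integrableOn_exp_mul_Ioi (a := -t) (by linarith) 0
  have h1' := integral_exp_mul_Ioi (a := -t) (by linarith) 0
  have h2 := integrableOn_exp_mul_complex_Ioi hre 0
  have h2' := integral_exp_mul_complex_Ioi hre 0
  have hcos : ∀ x : ℝ, (Complex.exp ((-t + Complex.I) * x)).re
      = Real.cos x * Real.exp (-t * x) := by
    intro x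
    rw [Complex.exp_re]
    simp [mul_comm]
  have h3 : IntegrableOn (fun x : ℝ => Real.cos x * Real.exp (-t * x)) (Ioi 0) :=
    h2.re.congr (.of_forall fun x => hcos x)
  have h3' : ∫ x : ℝ in Ioi 0, Real.cos x * Real.exp (-t * x) = t * (1 + t ^ 2)⁻¹ := by
    have := integral_re h2
    simp only [RCLike.re_to_complex, hcos] at this
    rw [this, h2']
    simp only [Complex.ofReal_zero, mul_zero, Complex.exp_zero, neg_div, one_div, Complex.neg_re,
      Complex.inv_re, Complex.normSq_apply]
    simp
    field_simp
    ring
  have heq : (fun x => (1 - Real.cos x) * Real.exp (-(t * x)))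
      = fun x => Real.exp (-t * x) - Real.cos x * Real.exp (-t * x) := by
    funext x; rw [neg_mul]; ring
  rw [heq]
  refine ⟨h1.sub h3, ?_⟩
  rw [integral_sub h1 h3, h1', h3']
  simp
  field_simp
  ring

lemma integral_rpow_div_one_add_sq {γ : ℝ} (h0 : 0 < γ) (h2 : γ < 2) :
    IntegrableOn (fun t : ℝ => t ^ (γ - 1) * (1 + t ^ 2)⁻¹) (Ioi 0) ∧
      ∫ t : ℝ in Ioi 0, t ^ (γ - 1) * (1 + t ^ 2)⁻¹
        = Real.pi / (2 * Real.sin (Real.pi * (γ / 2))) := by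
  have hsub : ∀ v > (0 : ℝ), ∀ t > (0 : ℝ), t ^ (γ - 1) * Real.exp (-(v * (1 + t ^ 2)))
      = Real.exp (-v) * (t ^ (γ - 1) * Real.exp (-v * t ^ (2 : ℝ))) := by
    intro v _ t _
    rw [Real.rpow_two, mul_left_comm, ← Real.exp_add]
    ring_nf
  obtain ⟨hi, he⟩ := integral_integral_swap_Ioi_of_nonneg
    (F := fun t v => t ^ (γ - 1) * Real.exp (-(v * (1 + t ^ 2))))
    (A := fun t => t ^ (γ - 1) * (1 + t ^ 2)⁻¹)
    (B := fun v => (Real.Gamma (γ / 2) / 2) * (Real.exp (-v) * v ^ ((1 - γ / 2) - 1)))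
    (by unfold Function.uncurry; fun_prop) (fun x hx t ht => by positivity)
    (fun t ht => by
      rw [integral_const_mul]
      have hp : 0 < 1 + t ^ 2 := by positivity
      have := integral_exp_mul_Ioi (a := -(1 + t ^ 2)) (by linarith) 0
      simp only [neg_mul, mul_zero, Real.exp_zero, mul_comm (1 + t ^ 2)] at this
      rw [this, neg_div_neg_eq, one_div])
    (fun v hv => by
      refine ((integrableOn_rpow_mul_exp_neg_mul_rpow (s := γ - 1) (by linarith) two_pos
        hv).const_mul (Real.exp (-v))).congr ?_
      exact (ae_restrict_iff' measurableSet_Ioi).2 (.of_forall fun t ht => (hsub v hv t ht).symm))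
    (fun v hv => by
      rw [setIntegral_congr_fun measurableSet_Ioi (fun t ht => hsub v hv t ht), integral_const_mul,
        integral_rpow_mul_exp_neg_mul_rpow two_pos (by linarith) hv,
        show -(γ - 1 + 1) / 2 = (1 - γ / 2) - 1 by ring, show (γ - 1 + 1) / 2 = γ / 2 by ring]
      ring)
    ((Real.GammaIntegral_convergent (by linarith)).const_mul _)
  refine ⟨hi, ?_⟩
  rw [he, integral_const_mul, ← Real.Gamma_eq_integral (by linarith)]
  have := Real.Gamma_mul_Gamma_one_sub (γ / 2)
  rw [div_mul_eq_mul_div, this, div_div, mul_comm (Real.sin _)]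

/-- The tail constant is `2 Γ(γ) sin(πγ/2) / π`, also at `γ = 1`. -/
lemma Cfun_eq {γ : ℝ} (h0 : 0 < γ) (h2 : γ < 2) :
    Cfun γ = 2 / Real.pi * Real.Gamma γ * Real.sin (Real.pi * γ / 2) := by
  unfold Cfun
  split_ifs with h
  · subst h; simp
  · have hrefl := Real.Gamma_mul_Gamma_one_sub γ
    have hG : Real.Gamma (2 - γ) = (1 - γ) * Real.Gamma (1 - γ) := by
      rw [← Real.Gamma_add_one (sub_ne_zero.2 (Ne.symm h))]; ring_nf
    have hsin : Real.sin (Real.pi * γ)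
        = 2 * Real.sin (Real.pi * γ / 2) * Real.cos (Real.pi * γ / 2) := by
      rw [← Real.sin_two_mul]; ring_nf
    have hspos : 0 < Real.sin (Real.pi * γ / 2) :=
      Real.sin_pos_of_pos_of_lt_pi (by positivity) (by nlinarith [Real.pi_pos])
    have hGpos := Real.Gamma_pos_of_pos h0
    have hc : Real.cos (Real.pi * γ / 2) ≠ 0 := by
      rcases lt_or_gt_of_ne h with h' | h'
      · exact (Real.cos_pos_of_mem_Ioo ⟨by nlinarith [Real.pi_pos], by nlinarith [Real.pi_pos]⟩).ne'
      · exact (Real.cos_neg_of_pi_div_two_lt_of_lt (by nlinarith [Real.pi_pos])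
          (by nlinarith [Real.pi_pos])).ne
    have h1 : (1 - γ) ≠ 0 := sub_ne_zero.2 (Ne.symm h)
    have hpi := Real.pi_ne_zero
    have hG2 : Real.Gamma (1 - γ) = Real.pi / (2 * Real.sin (Real.pi * γ / 2)
        * Real.cos (Real.pi * γ / 2) * Real.Gamma γ) := by
      rw [hsin] at hrefl
      field_simp at hrefl ⊢
      linarith
    rw [hG, hG2]
    generalize Real.sin (Real.pi * γ / 2) = s at hspos ⊢
    generalize Real.cos (Real.pi * γ / 2) = c at hc ⊢
    field_simp

lemma Cfun_pos {γ : ℝ} (h0 : 0 < γ) (h2 : γ < 2) : 0 < Cfun γ := by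
  rw [Cfun_eq h0 h2]
  have := Real.Gamma_pos_of_pos h0
  have : 0 < Real.sin (Real.pi * γ / 2) :=
    Real.sin_pos_of_pos_of_lt_pi (by positivity) (by nlinarith [Real.pi_pos])
  positivity

lemma integral_one_sub_cos_mul_rpow {γ : ℝ} (h0 : 0 < γ) (h2 : γ < 2) :
    IntegrableOn (fun x => (1 - Real.cos x) * x ^ (-1 - γ)) (Ioi 0) ∧
      ∫ x in Ioi 0, (1 - Real.cos x) * x ^ (-1 - γ) = (γ * Cfun γ)⁻¹ := by
  have hG : 0 < Real.Gamma (γ + 1) := Real.Gamma_pos_of_pos (by linarith)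
  obtain ⟨hi, he⟩ := integral_rpow_div_one_add_sq h0 h2
  obtain ⟨hi', he'⟩ := integral_integral_swap_Ioi_of_nonneg
    (F := fun x t => (1 - Real.cos x) * (t ^ γ * Real.exp (-(x * t))))
    (A := fun x => Real.Gamma (γ + 1) * ((1 - Real.cos x) * x ^ (-1 - γ)))
    (B := fun t => t ^ (γ - 1) * (1 + t ^ 2)⁻¹)
    (by unfold Function.uncurry; fun_prop)
    (fun x hx t ht => mul_nonneg (sub_nonneg.2 (Real.cos_le_one x)) (by positivity))
    (fun x hx => by
      have := Real.integral_rpow_mul_exp_neg_mul_Ioi (a := γ + 1) (r := x) (by linarith) hx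
      rw [add_sub_cancel_right] at this
      rw [integral_const_mul, this, one_div, Real.inv_rpow hx.le, ← Real.rpow_neg hx.le]
      ring_nf)
    (fun t ht => by
      refine ((integral_one_sub_cos_mul_exp ht).1.const_mul (t ^ γ)).congr (.of_forall fun x => ?_)
      dsimp only; rw [mul_comm x t]; ring)
    (fun t ht => by
      have h : ∀ x, (1 - Real.cos x) * (t ^ γ * Real.exp (-(x * t)))
          = t ^ γ * ((1 - Real.cos x) * Real.exp (-(t * x))) := by
        intro x; rw [mul_comm x t]; ring
      simp_rw [h]
      rw [integral_const_mul, (integral_one_sub_cos_mul_exp ht).2, Real.rpow_sub_one ht.ne']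
      ring) hi
  have hint : IntegrableOn (fun x => (1 - Real.cos x) * x ^ (-1 - γ)) (Ioi 0) := by
    refine (hi'.const_mul (Real.Gamma (γ + 1))⁻¹).congr (.of_forall fun x => ?_)
    dsimp only
    rw [inv_mul_cancel_left₀ hG.ne']
  refine ⟨hint, ?_⟩
  rw [integral_const_mul, he] at he'
  rw [eq_div_of_mul_eq hG.ne' ((mul_comm _ _).trans he'), Cfun_eq h0 h2, Real.Gamma_add_one h0.ne',
    mul_div_assoc]
  have hG' := Real.Gamma_pos_of_pos h0
  have : 0 < Real.sin (Real.pi * (γ / 2)) :=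
    Real.sin_pos_of_pos_of_lt_pi (by positivity) (by nlinarith [Real.pi_pos])
  have := Real.pi_pos
  field_simp

end TailConstant

section Cutoff

open Set

lemma abs_rpow_eq_integral_one_sub_cos {γ : ℝ} (h0 : 0 < γ) (h2 : γ < 2) (θ : ℝ) :
    IntegrableOn (fun x => (1 - Real.cos (θ * x)) * x ^ (-1 - γ)) (Ioi 0) ∧
      |θ| ^ γ = γ * Cfun γ * ∫ x in Ioi 0, (1 - Real.cos (θ * x)) * x ^ (-1 - γ) := by
  wlog hθ : 0 ≤ θ generalizing θ
  · have := this (-θ) (by linarith)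
    simpa only [abs_neg, neg_mul, Real.cos_neg] using this
  rcases hθ.eq_or_lt with rfl | hθ
  · simp [Real.zero_rpow h0.ne']
  obtain ⟨hi, he⟩ := integral_one_sub_cos_mul_rpow h0 h2
  have hscale : ∀ x > (0 : ℝ), θ ^ (1 + γ) * ((1 - Real.cos (θ * x)) * (θ * x) ^ (-1 - γ))
      = (1 - Real.cos (θ * x)) * x ^ (-1 - γ) := by
    intro x hx
    rw [Real.mul_rpow hθ.le hx.le, show -1 - γ = -(1 + γ) by ring, Real.rpow_neg hθ.le]
    have : 0 < θ ^ (1 + γ) := by positivity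
    field_simp
  have hi2 := (integrableOn_Ioi_comp_mul_left_iff
    (fun x => (1 - Real.cos x) * x ^ (-1 - γ)) 0 hθ).2 (by simpa using hi)
  constructor
  · refine (hi2.const_mul (θ ^ (1 + γ))).congr ?_
    exact (ae_restrict_iff' measurableSet_Ioi).2 (.of_forall fun x hx => hscale x hx)
  · rw [← setIntegral_congr_fun measurableSet_Ioi (fun x hx => hscale x hx), integral_const_mul,
      integral_comp_mul_left_Ioi (fun x => (1 - Real.cos x) * x ^ (-1 - γ)) 0 hθ, mul_zero, he,
      abs_of_pos hθ, Real.rpow_add hθ, Real.rpow_one, smul_eq_mul]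
    have := Cfun_pos h0 h2
    field_simp

/-- A continuous even cutoff function, equal to `1` on `[-r, r]` and vanishing outside `(-R, R)`,
which is the Fourier transform of a function `G` all of whose absolute moments are finite. -/
structure IsFourierCutoff (r R : ℝ) (g : ℝ → ℝ) (G : ℝ → ℂ) : Prop where
  continuous : Continuous g
  nonneg : ∀ x, 0 ≤ g x
  le_one : ∀ x, g x ≤ 1
  eq_one : ∀ x, |x| ≤ r → g x = 1
  eq_zero : ∀ x, R ≤ |x| → g x = 0
  even : ∀ x, g (-x) = g x
  continuous_fourier : Continuous G
  integrable_pow : ∀ k : ℕ, Integrable fun s => |s| ^ k * ‖G s‖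
  integral_eq : ∀ x : ℝ, ∫ s : ℝ, Complex.exp (Complex.I * s * x) * G s = g x

lemma exists_isFourierCutoff {r R : ℝ} (hr : 0 < r) (hrR : r < R) :
    ∃ g G, IsFourierCutoff r R g G := by
  let f : ContDiffBump (0 : ℝ) := ⟨r, R, hr, hrR⟩
  have hcs : HasCompactSupport (fun x => (f x : ℂ)) :=
    f.hasCompactSupport.comp_left (g := fun y : ℝ => (y : ℂ)) (by simp)
  have hsm : ContDiff ℝ ((⊤ : ℕ∞) : WithTop ℕ∞) (fun x => (f x : ℂ)) :=
    Complex.ofRealCLM.contDiff.comp f.contDiff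
  let S : SchwartzMap ℝ ℂ := hcs.toSchwartzMap hsm
  let Φ : SchwartzMap ℝ ℂ := FourierTransform.fourier S
  have hinv : ∀ x : ℝ, ∫ v : ℝ, Complex.exp (↑(2 * Real.pi * (v * x)) * Complex.I) * Φ v
      = (f x : ℂ) := by
    intro x
    have h1 : FourierTransformInv.fourierInv Φ = S := FourierTransform.fourierInv_fourier_eq S
    have h2 := congrArg (fun T : SchwartzMap ℝ ℂ => T x) h1
    simp only [SchwartzMap.fourierInv_coe, Real.fourierInv_eq'] at h2
    rw [show (f x : ℂ) = S x from rfl, ← h2]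
    refine integral_congr_ae (.of_forall fun v => ?_)
    simp [mul_comm v x]
  have hpi : (2 * Real.pi) ≠ 0 := by positivity
  refine ⟨f, fun s => ((2 * Real.pi)⁻¹ : ℝ) • Φ (s / (2 * Real.pi)), ?_⟩
  refine ⟨f.continuous, fun x => f.nonneg, fun x => f.le_one, fun x hx => ?_, fun x hx => ?_,
    f.neg, by have := Φ.continuous; fun_prop, fun k => ?_, fun x => ?_⟩
  · exact f.one_of_mem_closedBall (by simpa using hx)
  · exact f.zero_of_le_dist (by simpa using hx)
  · have := ((Φ.integrable_pow_mul volume k).comp_div hpi).const_mul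
      ((2 * Real.pi) ^ k * (2 * Real.pi)⁻¹)
    refine this.congr (.of_forall fun s => ?_)
    simp only [norm_smul, Real.norm_eq_abs, abs_div, abs_inv, abs_of_pos Real.two_pi_pos, div_pow]
    field_simp
  · rw [← hinv x]
    have hchange := Measure.integral_comp_div (fun v : ℝ =>
      Complex.exp (↑(2 * Real.pi * (v * x)) * Complex.I) * Φ v) (2 * Real.pi)
    rw [abs_of_pos Real.two_pi_pos] at hchange
    rw [← (inv_smul_eq_iff₀ hpi).2 hchange, ← integral_smul]
    refine integral_congr_ae (.of_forall fun s => ?_)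
    simp only [mul_smul_comm]
    congr 3
    rw [show 2 * Real.pi * (s / (2 * Real.pi) * x) = s * x by field_simp]
    push_cast; ring

namespace IsFourierCutoff

variable {r R : ℝ} {g : ℝ → ℝ} {G : ℝ → ℂ}

lemma integrable (h : IsFourierCutoff r R g G) : Integrable G := by
  refine (integrable_norm_iff h.continuous_fourier.aestronglyMeasurable).1 ?_
  simpa using h.integrable_pow 0

lemma integrable_weight (h : IsFourierCutoff r R g G) :
    Integrable fun s => (1 + s ^ 2) ^ 2 * ‖G s‖ := by
  refine (((h.integrable_pow 0).add ((h.integrable_pow 2).const_mul 2)).add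
    (h.integrable_pow 4)).congr (.of_forall fun s => ?_)
  have h4 : |s| ^ 4 = s ^ 4 := by rw [show 4 = 2 * 2 by rfl, pow_mul, sq_abs, ← pow_mul]
  simp only [Pi.add_apply, sq_abs, h4]
  ring

lemma integrable_exp (h : IsFourierCutoff r R g G) (x : ℝ) :
    Integrable fun s : ℝ => Complex.exp (Complex.I * s * x) * G s := by
  refine h.integrable.norm.mono' ?_ (.of_forall fun s => ?_)
  · have := h.continuous_fourier
    exact (by fun_prop : Continuous fun s : ℝ =>
      Complex.exp (Complex.I * s * x) * G s).aestronglyMeasurable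
  · rw [norm_mul, show Complex.I * s * x = ((s * x : ℝ) : ℂ) * Complex.I by push_cast; ring,
      Complex.norm_exp_ofReal_mul_I, one_mul]

lemma integral_fourier (h : IsFourierCutoff r R g G) (hr : 0 < r) : ∫ s, G s = 1 := by
  simpa [h.eq_one 0 (by simpa using hr.le)] using h.integral_eq 0

lemma integral_one_sub_cos (h : IsFourierCutoff r R g G) (hr : 0 < r) (x : ℝ) :
    ∫ s : ℝ, ((1 - Real.cos (s * x) : ℝ) : ℂ) * G s = ((1 - g x : ℝ) : ℂ) := by
  have heq : ∀ s : ℝ, ((1 - Real.cos (s * x) : ℝ) : ℂ) * G s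
      = G s - 2⁻¹ * (Complex.exp (Complex.I * s * x) * G s
        + Complex.exp (Complex.I * s * (-x : ℝ)) * G s) := by
    intro s
    push_cast
    rw [Complex.cos, show Complex.I * s * x = s * x * Complex.I by ring,
      show Complex.I * s * -x = -(s * x) * Complex.I by ring]
    ring
  have hsum : Integrable fun s : ℝ => Complex.exp (Complex.I * s * x) * G s
      + Complex.exp (Complex.I * s * (-x : ℝ)) * G s :=
    (h.integrable_exp x).add (h.integrable_exp (-x))
  simp_rw [heq]
  rw [integral_sub h.integrable (hsum.const_mul _), integral_const_mul,
    integral_add (h.integrable_exp x) (h.integrable_exp (-x)), h.integral_eq, h.integral_eq,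
    h.even, h.integral_fourier hr]
  push_cast; ring

lemma rpow_le_one_add_sq {γ : ℝ} (h0 : 0 < γ) (h2 : γ < 2) (s : ℝ) : |s| ^ γ ≤ 1 + s ^ 2 := by
  rcases le_total |s| 1 with hs | hs
  · nlinarith [Real.rpow_le_one (abs_nonneg s) hs h0.le, sq_nonneg s]
  · have := Real.rpow_le_rpow_of_exponent_le hs h2.le
    rw [Real.rpow_two, sq_abs] at this
    linarith

lemma integrable_rpow (h : IsFourierCutoff r R g G) {γ : ℝ} (h0 : 0 < γ) (h2 : γ < 2) :
    Integrable fun s : ℝ => |s| ^ γ * ‖G s‖ := by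
  refine h.integrable_weight.mono' ?_ (.of_forall fun s => ?_)
  · exact ((by fun_prop : Measurable fun s : ℝ => |s| ^ γ).mul
      h.continuous_fourier.norm.measurable).aestronglyMeasurable
  · rw [Real.norm_of_nonneg (by positivity)]
    have := rpow_le_one_add_sq h0 h2 s
    gcongr
    nlinarith [sq_nonneg s, sq_nonneg (s ^ 2)]

lemma integral_rpow (h : IsFourierCutoff r R g G) (hr : 0 < r) {γ : ℝ} (h0 : 0 < γ)
    (h2 : γ < 2) :
    ∫ s : ℝ, ((|s| ^ γ : ℝ) : ℂ) * G s
      = ((γ * Cfun γ * ∫ x in Ioi 0, (1 - g x) * x ^ (-1 - γ) : ℝ) : ℂ) := by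
  have hC := Cfun_pos h0 h2
  have hGm := h.continuous_fourier.measurable
  have hint : Integrable (Function.uncurry fun s x : ℝ =>
      (((1 - Real.cos (s * x)) * x ^ (-1 - γ) : ℝ) : ℂ) * G s)
      (volume.prod (volume.restrict (Ioi 0))) := by
    have hm : Measurable (Function.uncurry fun s x : ℝ =>
      (((1 - Real.cos (s * x)) * x ^ (-1 - γ) : ℝ) : ℂ) * G s) := by
      unfold Function.uncurry; fun_prop
    rw [integrable_prod_iff hm.aestronglyMeasurable]
    refine ⟨.of_forall fun s => ?_, ?_⟩
    · exact ((abs_rpow_eq_integral_one_sub_cos h0 h2 s).1.ofReal (𝕜 := ℂ)).mul_const (G s)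
    · refine ((h.integrable_rpow h0 h2).const_mul (γ * Cfun γ)⁻¹).congr (.of_forall fun s => ?_)
      have : ∀ x ∈ Ioi (0 : ℝ), ‖(((1 - Real.cos (s * x)) * x ^ (-1 - γ) : ℝ) : ℂ) * G s‖
          = ((1 - Real.cos (s * x)) * x ^ (-1 - γ)) * ‖G s‖ := by
        intro x hx
        rw [norm_mul, Complex.norm_real, Real.norm_of_nonneg]
        exact mul_nonneg (sub_nonneg.2 (Real.cos_le_one _)) (Real.rpow_nonneg (le_of_lt hx) _)
      simp only [Function.uncurry]
      rw [setIntegral_congr_fun measurableSet_Ioi this, integral_mul_const,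
        (abs_rpow_eq_integral_one_sub_cos h0 h2 s).2]
      field_simp
  have hswap := integral_integral_swap hint
  have hleft : ∀ s : ℝ, ((|s| ^ γ : ℝ) : ℂ) * G s = ((γ * Cfun γ : ℝ) : ℂ) *
      ∫ x in Ioi 0, (((1 - Real.cos (s * x)) * x ^ (-1 - γ) : ℝ) : ℂ) * G s := by
    intro s
    rw [integral_mul_const, integral_complex_ofReal, (abs_rpow_eq_integral_one_sub_cos h0 h2 s).2,
      ← mul_assoc, ← Complex.ofReal_mul]
  have hright : ∀ x : ℝ, ∫ s : ℝ, (((1 - Real.cos (s * x)) * x ^ (-1 - γ) : ℝ) : ℂ) * G s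
      = (((1 - g x) * x ^ (-1 - γ) : ℝ) : ℂ) := by
    intro x
    rw [Complex.ofReal_mul, ← h.integral_one_sub_cos hr, ← integral_mul_const]
    refine integral_congr_ae (.of_forall fun s => ?_)
    dsimp only
    push_cast; ring
  simp_rw [hleft]
  rw [integral_const_mul, hswap]
  simp_rw [hright]
  rw [integral_complex_ofReal, ← Complex.ofReal_mul]

lemma mul_integral_mem_Icc (h : IsFourierCutoff r R g G) (hr : 0 < r) (hrR : r < R) {γ : ℝ}
    (h0 : 0 < γ) :
    γ * ∫ x in Ioi 0, (1 - g x) * x ^ (-1 - γ) ∈ Icc (R ^ (-γ)) (r ^ (-γ)) := by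
  have hR : 0 < R := hr.trans hrR
  have hval : ∀ c > 0, ∫ x : ℝ in Ioi c, x ^ (-1 - γ) = c ^ (-γ) / γ := by
    intro c hc
    rw [integral_Ioi_rpow_of_lt (by linarith) hc, show -1 - γ + 1 = -γ by ring, neg_div_neg_eq]
  have hdom : IntegrableOn (fun x : ℝ => x ^ (-1 - γ)) (Ioi r) :=
    integrableOn_Ioi_rpow_of_lt (by linarith) hr
  have hle : ∀ x ∈ Ioi r, (1 - g x) * x ^ (-1 - γ) ≤ x ^ (-1 - γ) := fun x hx =>
    mul_le_of_le_one_left (Real.rpow_nonneg (hr.trans hx).le _) (by linarith [h.nonneg x])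
  have hnn : ∀ x ∈ Ioi r, 0 ≤ (1 - g x) * x ^ (-1 - γ) := fun x hx =>
    mul_nonneg (by linarith [h.le_one x]) (Real.rpow_nonneg (hr.trans hx).le _)
  have hi : IntegrableOn (fun x => (1 - g x) * x ^ (-1 - γ)) (Ioi r) := by
    refine hdom.mono' ?_ ((ae_restrict_iff' measurableSet_Ioi).2 (.of_forall fun x hx => ?_))
    · have := h.continuous.measurable
      exact (by fun_prop : Measurable fun x => (1 - g x) * x ^ (-1 - γ)).aestronglyMeasurable
    · rw [Real.norm_of_nonneg (hnn x hx)]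
      exact hle x hx
  have hcut : ∫ x in Ioi 0, (1 - g x) * x ^ (-1 - γ) = ∫ x in Ioi r, (1 - g x) * x ^ (-1 - γ) := by
    refine setIntegral_eq_of_subset_of_forall_sdiff_eq_zero measurableSet_Ioi
      (Ioi_subset_Ioi hr.le) fun x hx => ?_
    have hx0 : 0 < x := hx.1
    have hxr : x ≤ r := not_lt.1 hx.2
    rw [h.eq_one x (by rwa [abs_of_pos hx0]), sub_self, zero_mul]
  rw [hcut]
  constructor
  · have h1 : ∫ x in Ioi R, (1 - g x) * x ^ (-1 - γ) ≤ ∫ x in Ioi r, (1 - g x) * x ^ (-1 - γ) :=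
      setIntegral_mono_set hi ((ae_restrict_iff' measurableSet_Ioi).2 (.of_forall hnn))
        (Ioi_subset_Ioi hrR.le).eventuallyLE
    have h2 : ∫ x in Ioi R, (1 - g x) * x ^ (-1 - γ) = R ^ (-γ) / γ := by
      rw [← hval R hR]
      refine setIntegral_congr_fun measurableSet_Ioi fun x hx => ?_
      have : R ≤ |x| := (le_of_lt hx).trans (le_abs_self x)
      simp [h.eq_zero x this]
    rw [h2, div_le_iff₀ h0] at h1
    linarith
  · have h1 := setIntegral_mono_on hi hdom measurableSet_Ioi hle
    rw [hval r hr, le_div_iff₀ h0] at h1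
    linarith

end IsFourierCutoff

end Cutoff

section TailEstimate

open Set

variable {a b lam : ℝ} {ν μ : Measure ℝ}

lemma continuousOn_Cfun : ContinuousOn Cfun (Ioo 0 2) := by
  have h : ContinuousOn (fun γ => 2 / Real.pi * Real.Gamma γ * Real.sin (Real.pi * γ / 2))
      (Ioo 0 2) := by
    intro γ hγ
    have hG : ContinuousAt Real.Gamma γ := (Real.differentiableAt_Gamma fun m =>
      ((neg_nonpos.2 m.cast_nonneg).trans_lt hγ.1).ne').continuousAt
    exact ((continuousAt_const.mul hG).mul (by fun_prop)).continuousWithinAt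
  exact h.congr fun γ hγ => Cfun_eq hγ.1 hγ.2

lemma exists_Cfun_bounds (ha : 0 < a) (hab : a ≤ b) (hb : b < 2) :
    ∃ c > 0, ∃ K, ∀ γ ∈ Icc a b, c ≤ Cfun γ ∧ Cfun γ ≤ K := by
  have hsub : Icc a b ⊆ Ioo 0 2 := fun γ hγ => ⟨ha.trans_le hγ.1, hγ.2.trans_lt hb⟩
  have hc := continuousOn_Cfun.mono hsub
  obtain ⟨γ₀, hγ₀, hmin⟩ := isCompact_Icc.exists_isMinOn (nonempty_Icc.2 hab) hc
  obtain ⟨γ₁, _, hmax⟩ := isCompact_Icc.exists_isMaxOn (nonempty_Icc.2 hab) hc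
  exact ⟨Cfun γ₀, Cfun_pos (hsub hγ₀).1 (hsub hγ₀).2, Cfun γ₁, fun γ hγ => ⟨hmin hγ, hmax hγ⟩⟩

lemma integrable_rpow_neg [IsProbabilityMeasure ν] (ha : 0 < a) (hν : ∀ᵐ γ ∂ν, γ ∈ Icc a b)
    (hlam : 1 ≤ lam) : Integrable (fun γ => lam ^ (-γ)) ν := by
  refine (integrable_const (1 : ℝ)).mono' (by fun_prop : Measurable _).aestronglyMeasurable ?_
  filter_upwards [hν] with γ hγ
  rw [Real.norm_of_nonneg (by positivity)]
  exact Real.rpow_le_one_of_one_le_of_nonpos hlam (by linarith [hγ.1])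

lemma integral_rpow_neg_le [IsProbabilityMeasure ν] (ha : 0 < a) (hν : ∀ᵐ γ ∂ν, γ ∈ Icc a b)
    (hlam : 1 ≤ lam) : ∫ γ, lam ^ (-γ) ∂ν ≤ lam ^ (-a) := by
  calc ∫ γ, lam ^ (-γ) ∂ν ≤ ∫ _, lam ^ (-a) ∂ν := by
        refine integral_mono_ae (integrable_rpow_neg ha hν hlam) (integrable_const _) ?_
        filter_upwards [hν] with γ hγ
        exact Real.rpow_le_rpow_of_exponent_le hlam (by linarith [hγ.1])
    _ = lam ^ (-a) := by simp

lemma integrable_rpow_neg_mul_Cfun [IsProbabilityMeasure ν] (ha : 0 < a) (hab : a ≤ b)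
    (hb : b < 2) (hν : ∀ᵐ γ ∂ν, γ ∈ Icc a b) (hlam : 1 ≤ lam) :
    Integrable (fun γ => lam ^ (-γ) * Cfun γ) ν := by
  obtain ⟨c, hc, K, hcK⟩ := exists_Cfun_bounds ha hab hb
  have hsub : Icc a b ⊆ Ioo 0 2 := fun γ hγ => ⟨ha.trans_le hγ.1, hγ.2.trans_lt hb⟩
  have hmeas : AEStronglyMeasurable Cfun ν := by
    rw [← Measure.restrict_eq_self_of_ae_mem hν]
    exact (continuousOn_Cfun.mono hsub).aestronglyMeasurable measurableSet_Icc
  refine (integrable_rpow_neg ha hν hlam).mul_bdd (c := K) hmeas ?_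
  filter_upwards [hν] with γ hγ
  rw [Real.norm_of_nonneg (hc.le.trans (hcK γ hγ).1)]
  exact (hcK γ hγ).2

lemma abs_one_sub_exp_neg_sub_le {y : ℝ} (hy : 0 ≤ y) : |1 - Real.exp (-y) - y| ≤ y ^ 2 := by
  rw [abs_le]
  have h1 := Real.add_one_le_exp (-y)
  refine ⟨?_, by nlinarith⟩
  rcases le_total y 1 with h | h
  · have := Real.abs_exp_sub_one_sub_id_le (x := -y) (by rwa [abs_neg, abs_of_nonneg hy])
    have := (abs_le.1 this).2
    nlinarith
  · have := Real.exp_le_one_iff.2 (neg_nonpos.2 hy)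
    nlinarith

namespace IsFourierCutoff

variable {r R : ℝ} {g : ℝ → ℝ} {G : ℝ → ℂ}

lemma integral_comp_div_eq [IsProbabilityMeasure μ] (h : IsFourierCutoff r R g G) {φ : ℝ → ℝ}
    (hμ : ∀ θ : ℝ, ∫ x : ℝ, Complex.exp (Complex.I * θ * x) ∂μ = (φ θ : ℂ)) :
    ((∫ x, g (x / lam) ∂μ : ℝ) : ℂ) = ∫ s, (φ (s / lam) : ℂ) * G s := by
  have hint : Integrable (Function.uncurry fun x s : ℝ =>
      Complex.exp (Complex.I * s * (x / lam : ℝ)) * G s) (μ.prod volume) := by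
    refine (h.integrable.norm.comp_snd μ).mono' ?_ (.of_forall fun p => ?_)
    · have := h.continuous_fourier.measurable
      exact (by unfold Function.uncurry; fun_prop : Measurable (Function.uncurry fun x s : ℝ =>
        Complex.exp (Complex.I * s * (x / lam : ℝ)) * G s)).aestronglyMeasurable
    · simp only [Function.uncurry]
      rw [norm_mul, show Complex.I * p.2 * (p.1 / lam : ℝ) = ((p.2 * (p.1 / lam) : ℝ) : ℂ)
        * Complex.I by push_cast; ring, Complex.norm_exp_ofReal_mul_I, one_mul]
  rw [← integral_complex_ofReal]
  simp_rw [← h.integral_eq]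
  rw [integral_integral_swap hint]
  refine integral_congr_ae (.of_forall fun s => ?_)
  dsimp only
  rw [integral_mul_const, ← hμ]
  congr 1
  refine integral_congr_ae (.of_forall fun x => ?_)
  dsimp only
  congr 1
  push_cast; ring

lemma integrable_prod [IsProbabilityMeasure ν] (h : IsFourierCutoff r R g G) (ha : 0 < a)
    (hb : b < 2) (hν : ∀ᵐ γ ∂ν, γ ∈ Icc a b) (hlam : 1 ≤ lam) :
    Integrable (Function.uncurry fun γ s : ℝ => ((|s / lam| ^ γ : ℝ) : ℂ) * G s)
      (ν.prod volume) := by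
  have hGm := h.continuous_fourier.measurable
  refine (h.integrable_weight.comp_snd ν).mono' ?_ ?_
  · exact (by unfold Function.uncurry; fun_prop : Measurable (Function.uncurry fun γ s : ℝ =>
      ((|s / lam| ^ γ : ℝ) : ℂ) * G s)).aestronglyMeasurable
  · filter_upwards [Measure.quasiMeasurePreserving_fst.ae hν] with p hp
    simp only [Function.uncurry]
    rw [norm_mul, Complex.norm_real, Real.norm_of_nonneg (by positivity)]
    have h1 : |p.2 / lam| ^ p.1 ≤ |p.2| ^ p.1 := by
      refine Real.rpow_le_rpow (abs_nonneg _) ?_ (ha.le.trans hp.1)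
      rw [abs_div, abs_of_pos (by linarith : 0 < lam)]
      exact div_le_self (abs_nonneg _) hlam
    have h2 := rpow_le_one_add_sq (ha.trans_le hp.1) (hp.2.trans_lt hb) p.2
    gcongr
    nlinarith [sq_nonneg p.2, sq_nonneg (p.2 ^ 2)]

lemma integral_exponent_mul [IsProbabilityMeasure ν] (h : IsFourierCutoff r R g G) (hr : 0 < r)
    (ha : 0 < a) (hb : b < 2) (hν : ∀ᵐ γ ∂ν, γ ∈ Icc a b) (hlam : 1 ≤ lam) :
    Integrable (fun γ => lam ^ (-γ) * Cfun γ *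
        (γ * ∫ x in Ioi 0, (1 - g x) * x ^ (-1 - γ))) ν ∧
      ∫ s, ((∫ γ, |s / lam| ^ γ ∂ν : ℝ) : ℂ) * G s
        = ((∫ γ, lam ^ (-γ) * Cfun γ *
          (γ * ∫ x in Ioi 0, (1 - g x) * x ^ (-1 - γ)) ∂ν : ℝ) : ℂ) := by
  have hint := h.integrable_prod ha hb hν hlam
  have hlam0 : 0 < lam := by linarith
  have hinner : ∀ᵐ γ ∂ν, ∫ s : ℝ, ((|s / lam| ^ γ : ℝ) : ℂ) * G s
      = ((lam ^ (-γ) * Cfun γ * (γ * ∫ x in Ioi 0, (1 - g x) * x ^ (-1 - γ)) : ℝ) : ℂ) := by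
    filter_upwards [hν] with γ hγ
    have heq : ∀ s : ℝ, ((|s / lam| ^ γ : ℝ) : ℂ) * G s
        = ((lam ^ (-γ) : ℝ) : ℂ) * (((|s| ^ γ : ℝ) : ℂ) * G s) := by
      intro s
      rw [← mul_assoc, ← Complex.ofReal_mul, abs_div, abs_of_pos hlam0,
        Real.div_rpow (abs_nonneg s) hlam0.le, Real.rpow_neg hlam0.le]
      ring_nf
    simp_rw [heq]
    rw [integral_const_mul, h.integral_rpow hr (ha.trans_le hγ.1) (hγ.2.trans_lt hb),
      ← Complex.ofReal_mul]
    congr 1; ring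
  constructor
  · have := (hint.integral_prod_left.congr hinner).re
    simpa using this
  · have hswap := integral_integral_swap hint
    rw [← integral_complex_ofReal, ← integral_congr_ae hinner, hswap]
    refine integral_congr_ae (.of_forall fun s => ?_)
    dsimp only
    rw [integral_mul_const, integral_complex_ofReal]

lemma abs_sub_integral_le [IsProbabilityMeasure ν] [IsProbabilityMeasure μ]
    (h : IsFourierCutoff r R g G) (hr : 0 < r) (ha : 0 < a) (hb : b < 2)
    (hν : ∀ᵐ γ ∂ν, γ ∈ Icc a b) (hlam : 1 ≤ lam)
    (hμ : ∀ θ : ℝ, ∫ x : ℝ, Complex.exp (Complex.I * θ * x) ∂μ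
      = (Real.exp (-∫ γ, |θ| ^ γ ∂ν) : ℂ)) :
    |(1 - ∫ x, g (x / lam) ∂μ) - ∫ γ, lam ^ (-γ) * Cfun γ *
        (γ * ∫ x in Ioi 0, (1 - g x) * x ^ (-1 - γ)) ∂ν|
      ≤ (∫ s, (1 + s ^ 2) ^ 2 * ‖G s‖) * lam ^ (-a) * ∫ γ, lam ^ (-γ) ∂ν := by
  have hlam0 : 0 < lam := by linarith
  have hGm := h.continuous_fourier.measurable
  set P : ℝ → ℝ := fun s => ∫ γ, |s / lam| ^ γ ∂ν with hP
  set S : ℝ := ∫ γ, lam ^ (-γ) ∂ν with hS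
  have hP0 : ∀ s, 0 ≤ P s := fun s => integral_nonneg fun γ => by positivity
  have hS0 : 0 ≤ S := integral_nonneg fun γ => by positivity
  have hSa : S ≤ lam ^ (-a) := integral_rpow_neg_le ha hν hlam
  have hPS : ∀ s, P s ≤ (1 + s ^ 2) * S := by
    intro s
    rw [hS, ← integral_const_mul]
    refine integral_mono_of_nonneg (.of_forall fun γ => by positivity)
      ((integrable_rpow_neg ha hν hlam).const_mul _) ?_
    filter_upwards [hν] with γ hγ
    rw [abs_div, abs_of_pos hlam0, Real.div_rpow (abs_nonneg s) hlam0.le, Real.rpow_neg hlam0.le,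
      div_eq_mul_inv]
    have := rpow_le_one_add_sq (ha.trans_le hγ.1) (hγ.2.trans_lt hb) s
    gcongr
  have hPm : Measurable P := by
    have : StronglyMeasurable (Function.uncurry fun s γ : ℝ => |s / lam| ^ γ) :=
      (by unfold Function.uncurry; fun_prop : Measurable _).stronglyMeasurable
    exact this.integral_prod_right.measurable
  have hφ := h.integral_comp_div_eq (lam := lam) hμ
  obtain ⟨-, hM⟩ := h.integral_exponent_mul hr ha hb hν hlam
  have hexp : Integrable fun s => (Real.exp (-P s) : ℂ) * G s := by
    refine h.integrable.bdd_mul (c := 1)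
      (by fun_prop : Measurable fun s => (Real.exp (-P s) : ℂ)).aestronglyMeasurable
      (.of_forall fun s => ?_)
    rw [Complex.norm_real, Real.norm_of_nonneg (Real.exp_nonneg _)]
    exact Real.exp_le_one_iff.2 (neg_nonpos.2 (hP0 s))
  have hPG : Integrable fun s => (P s : ℂ) * G s := by
    refine (h.integrable_weight.const_mul S).mono'
      (by fun_prop : Measurable fun s => (P s : ℂ) * G s).aestronglyMeasurable
      (.of_forall fun s => ?_)
    rw [norm_mul, Complex.norm_real, Real.norm_of_nonneg (hP0 s), ← mul_assoc]
    have h1 := hPS s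
    have h2 : (1 + s ^ 2) * S ≤ S * (1 + s ^ 2) ^ 2 := by
      nlinarith [mul_nonneg hS0 (sq_nonneg s), mul_nonneg hS0 (sq_nonneg (s ^ 2))]
    gcongr
    exact h1.trans h2
  have hkey : (((1 - ∫ x, g (x / lam) ∂μ) - ∫ γ, lam ^ (-γ) * Cfun γ *
        (γ * ∫ x in Ioi 0, (1 - g x) * x ^ (-1 - γ)) ∂ν : ℝ) : ℂ)
      = ∫ s, ((1 - Real.exp (-P s) - P s : ℝ) : ℂ) * G s := by
    have hdiff : Integrable fun s => G s - (Real.exp (-P s) : ℂ) * G s := h.integrable.sub hexp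
    rw [Complex.ofReal_sub, Complex.ofReal_sub, Complex.ofReal_one, hφ, ← hM,
      ← h.integral_fourier hr, ← integral_sub h.integrable hexp, ← integral_sub hdiff hPG]
    refine integral_congr_ae (.of_forall fun s => ?_)
    dsimp only
    push_cast; ring
  rw [← Real.norm_eq_abs, ← Complex.norm_real, hkey]
  refine (norm_integral_le_of_norm_le (h.integrable_weight.const_mul (lam ^ (-a) * S))
    (.of_forall fun s => ?_)).trans_eq ?_
  · rw [norm_mul, Complex.norm_real, Real.norm_eq_abs]
    have h1 : P s ^ 2 ≤ lam ^ (-a) * S * (1 + s ^ 2) ^ 2 := by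
      calc P s ^ 2 ≤ ((1 + s ^ 2) * S) ^ 2 := pow_le_pow_left₀ (hP0 s) (hPS s) 2
        _ = S * S * (1 + s ^ 2) ^ 2 := by ring
        _ ≤ _ := by gcongr
    rw [← mul_assoc]
    exact mul_le_mul_of_nonneg_right ((abs_one_sub_exp_neg_sub_le (hP0 s)).trans h1) (norm_nonneg _)
  · rw [integral_const_mul]; ring

lemma integrable_comp_div [IsProbabilityMeasure μ] (h : IsFourierCutoff r R g G) :
    Integrable (fun x => g (x / lam)) μ := by
  have := h.continuous
  refine (integrable_const (1 : ℝ)).mono'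
    (by fun_prop : Continuous fun x => g (x / lam)).aestronglyMeasurable (.of_forall fun x => ?_)
  rw [Real.norm_of_nonneg (h.nonneg _)]
  exact h.le_one _

lemma one_sub_integral_eq [IsProbabilityMeasure μ] (h : IsFourierCutoff r R g G) :
    1 - ∫ x, g (x / lam) ∂μ = ∫ x, (1 - g (x / lam)) ∂μ := by
  rw [integral_sub (integrable_const _) h.integrable_comp_div]
  simp

lemma measureReal_le [IsProbabilityMeasure μ] (h : IsFourierCutoff r 1 g G) (hlam : 0 < lam) :
    μ.real {x | lam < |x|} ≤ 1 - ∫ x, g (x / lam) ∂μ := by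
  have hs : MeasurableSet {x : ℝ | lam < |x|} := measurableSet_lt measurable_const (by fun_prop)
  rw [h.one_sub_integral_eq, ← integral_indicator_one hs]
  refine integral_mono ((integrable_const _).indicator hs)
    ((integrable_const _).sub h.integrable_comp_div) fun x => ?_
  by_cases hx : lam < |x|
  · have : 1 ≤ |x / lam| := by
      rw [abs_div, abs_of_pos hlam, le_div_iff₀ hlam]; linarith
    simp [hx, h.eq_zero _ this]
  · simpa [hx] using h.le_one (x / lam)

lemma le_measureReal [IsProbabilityMeasure μ] (h : IsFourierCutoff 1 R g G) (hlam : 0 < lam) :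
    1 - ∫ x, g (x / lam) ∂μ ≤ μ.real {x | lam < |x|} := by
  have hs : MeasurableSet {x : ℝ | lam < |x|} := measurableSet_lt measurable_const (by fun_prop)
  rw [h.one_sub_integral_eq, ← integral_indicator_one hs]
  refine integral_mono ((integrable_const _).sub h.integrable_comp_div)
    ((integrable_const _).indicator hs) fun x => ?_
  by_cases hx : lam < |x|
  · simpa [hx] using h.nonneg (x / lam)
  · have : |x / lam| ≤ 1 := by
      rw [abs_div, abs_of_pos hlam, div_le_one hlam]; exact not_lt.1 hx
    simp [hx, h.eq_one _ this]

end IsFourierCutoff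

/-- Uniform tail asymptotics for the law whose characteristic function is
`θ ↦ exp (-∫ |θ| ^ γ dν(γ))`, over all probability measures `ν` on `[a, b]`. -/
theorem exists_forall_abs_tail_div_sub_one_le (ha : 0 < a) (hab : a ≤ b) (hb : b < 2) {ε : ℝ}
    (hε : 0 < ε) :
    ∃ Λ ≥ 1, ∀ lam ≥ Λ, ∀ (ν μ : Measure ℝ) [IsProbabilityMeasure ν] [IsProbabilityMeasure μ],
      (∀ᵐ γ ∂ν, γ ∈ Icc a b) →
      (∀ θ : ℝ, ∫ x : ℝ, Complex.exp (Complex.I * θ * x) ∂μ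
        = (Real.exp (-∫ γ, |θ| ^ γ ∂ν) : ℂ)) →
      |μ.real {x | lam < |x|} / (∫ γ, lam ^ (-γ) * Cfun γ ∂ν) - 1| ≤ ε := by
  obtain ⟨c, hc, K, hcK⟩ := exists_Cfun_bounds ha hab hb
  set η := ε / 2 with hη
  have hη0 : 0 < η := by positivity
  set ρ := Real.sqrt (1 + η) with hρ
  have hρsq : ρ ^ 2 = 1 + η := Real.sq_sqrt (by positivity)
  have hρ1 : 1 < ρ := by rw [hρ, Real.lt_sqrt] <;> linarith
  have hρ0 : 0 < ρ := by linarith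
  have hρinv : ρ⁻¹ < 1 := inv_lt_one_of_one_lt₀ hρ1
  obtain ⟨g₁, G₁, h₁⟩ := exists_isFourierCutoff (inv_pos.2 hρ0) hρinv
  obtain ⟨g₂, G₂, h₂⟩ := exists_isFourierCutoff one_pos hρ1
  set K₁ := ∫ s, (1 + s ^ 2) ^ 2 * ‖G₁ s‖
  set K₂ := ∫ s, (1 + s ^ 2) ^ 2 * ‖G₂ s‖
  have hlim : ∀ k : ℝ, ∀ᶠ lam : ℝ in Filter.atTop, k * lam ^ (-a) ≤ η * c := by
    intro k
    have := (tendsto_rpow_neg_atTop ha).const_mul k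
    rw [mul_zero] at this
    exact this.eventually_le_const (by positivity)
  obtain ⟨Λ, hΛ⟩ := Filter.eventually_atTop.1 ((hlim K₁).and (hlim K₂))
  refine ⟨max Λ 1, le_max_right _ _, fun lam hlam ν μ _ _ hν hμ => ?_⟩
  obtain ⟨hk₁, hk₂⟩ := hΛ lam ((le_max_left _ _).trans hlam)
  have hlam1 : 1 ≤ lam := (le_max_right _ _).trans hlam
  have hlam0 : 0 < lam := by linarith
  have hTint := integrable_rpow_neg_mul_Cfun ha hab hb hν hlam1
  have hSint := integrable_rpow_neg ha hν hlam1
  set T := ∫ γ, lam ^ (-γ) * Cfun γ ∂ν with hT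
  set S := ∫ γ, lam ^ (-γ) ∂ν with hS
  have hS0 : 0 < S := by
    refine (integral_pos_iff_support_of_nonneg (fun γ => by positivity) hSint).2 ?_
    have : Function.support (fun γ : ℝ => lam ^ (-γ)) = univ :=
      Function.support_eq_univ fun γ => (Real.rpow_pos_of_pos hlam0 _).ne'
    rw [this]; simp
  have hST : c * S ≤ T := by
    rw [hS, hT, ← integral_const_mul]
    refine integral_mono_ae (hSint.const_mul c) hTint ?_
    filter_upwards [hν] with γ hγ
    rw [mul_comm]
    have := (hcK γ hγ).1
    gcongr
  have hT0 : 0 < T := (mul_pos hc hS0).trans_le hST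
  have herr : ∀ k, k * lam ^ (-a) ≤ η * c → k * lam ^ (-a) * S ≤ η * T := fun k hk =>
    calc k * lam ^ (-a) * S ≤ η * c * S := by gcongr
      _ = η * (c * S) := by ring
      _ ≤ η * T := by gcongr
  have hw : ∀ᵐ γ ∂ν, 0 ≤ lam ^ (-γ) * Cfun γ := by
    filter_upwards [hν] with γ hγ
    exact mul_nonneg (by positivity) (hc.le.trans (hcK γ hγ).1)
  have hpow : ∀ γ ∈ Icc a b, ρ ^ γ ≤ 1 + η := fun γ hγ => by
    rw [← hρsq, ← Real.rpow_two]
    exact Real.rpow_le_rpow_of_exponent_le hρ1.le (hγ.2.trans hb.le)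
  have hupper : ∫ γ, lam ^ (-γ) * Cfun γ * (γ * ∫ x in Ioi 0, (1 - g₁ x) * x ^ (-1 - γ)) ∂ν
      ≤ (1 + η) * T := by
    rw [hT, ← integral_const_mul]
    refine integral_mono_ae (h₁.integral_exponent_mul (inv_pos.2 hρ0) ha hb hν hlam1).1
      (hTint.const_mul _) ?_
    filter_upwards [hν, hw] with γ hγ hwγ
    rw [mul_comm (1 + η)]
    refine mul_le_mul_of_nonneg_left ?_ hwγ
    refine (h₁.mul_integral_mem_Icc (inv_pos.2 hρ0) hρinv (ha.trans_le hγ.1)).2.trans ?_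
    rw [Real.inv_rpow hρ0.le, Real.rpow_neg hρ0.le, inv_inv]
    exact hpow γ hγ
  have hlower : (1 - η) * T
      ≤ ∫ γ, lam ^ (-γ) * Cfun γ * (γ * ∫ x in Ioi 0, (1 - g₂ x) * x ^ (-1 - γ)) ∂ν := by
    rw [hT, ← integral_const_mul]
    refine integral_mono_ae (hTint.const_mul _)
      (h₂.integral_exponent_mul one_pos ha hb hν hlam1).1 ?_
    filter_upwards [hν, hw] with γ hγ hwγ
    rw [mul_comm (1 - η)]
    refine mul_le_mul_of_nonneg_left ?_ hwγ
    refine le_trans ?_ (h₂.mul_integral_mem_Icc one_pos hρ1 (ha.trans_le hγ.1)).1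
    rw [Real.rpow_neg hρ0.le]
    calc 1 - η ≤ (1 + η)⁻¹ := by
          rw [← one_div, le_div_iff₀ (by positivity)]
          nlinarith
      _ ≤ (ρ ^ γ)⁻¹ := by
          have := hpow γ hγ
          gcongr
  have he₁ := (abs_le.1 (h₁.abs_sub_integral_le (inv_pos.2 hρ0) ha hb hν hlam1 hμ)).2
  have he₂ := (abs_le.1 (h₂.abs_sub_integral_le one_pos ha hb hν hlam1 hμ)).1
  have hm₁ := h₁.measureReal_le (μ := μ) hlam0
  have hm₂ := h₂.le_measureReal (μ := μ) hlam0
  have hr₁ := herr K₁ hk₁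
  have hr₂ := herr K₂ hk₂
  rw [div_sub_one hT0.ne', abs_div, abs_of_pos hT0, div_le_iff₀ hT0, abs_le]
  have hεη : ε * T = 2 * (η * T) := by rw [hη]; ring
  constructor <;> linarith

end TailEstimate

section ExponentLaw

variable {α f : ℝ → ℝ}

/-- The law of the exponent `α` under the measure with density `|f| ^ α`. -/
noncomputable def exponentLaw (α f : ℝ → ℝ) : Measure ℝ :=
  (volume.withDensity fun x => ENNReal.ofReal (|f x| ^ α x)).map α

lemma isProbabilityMeasure_exponentLaw (hα : Measurable α) (hf : MemSα α f) :
    IsProbabilityMeasure (exponentLaw α f) := by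
  have : IsProbabilityMeasure (volume.withDensity fun x => ENNReal.ofReal (|f x| ^ α x)) := by
    constructor
    rw [withDensity_apply _ MeasurableSet.univ, Measure.restrict_univ,
      ← ofReal_integral_eq_lintegral_ofReal hf.2.1 (.of_forall fun x => by positivity), hf.2.2,
      ENNReal.ofReal_one]
  exact Measure.isProbabilityMeasure_map hα.aemeasurable

lemma ae_exponentLaw_mem {a b : ℝ} (hα : Measurable α) (hab : ∀ x, α x ∈ Set.Icc a b) :
    ∀ᵐ γ ∂exponentLaw α f, γ ∈ Set.Icc a b :=
  (ae_map_iff hα.aemeasurable measurableSet_Icc).2 (.of_forall hab)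

lemma integral_exponentLaw {F : ℝ → ℝ} (hα : Measurable α) (hf : MemSα α f)
    (hF : AEStronglyMeasurable F (exponentLaw α f)) :
    ∫ γ, F γ ∂exponentLaw α f = ∫ x, |f x| ^ α x * F (α x) := by
  have hfm := hf.1
  rw [exponentLaw, integral_map hα.aemeasurable hF,
    integral_withDensity_eq_integral_toReal_smul (by fun_prop)
      (.of_forall fun x => ENNReal.ofReal_lt_top)]
  refine integral_congr_ae (.of_forall fun x => ?_)
  dsimp only
  rw [ENNReal.toReal_ofReal (by positivity), smul_eq_mul]

end ExponentLaw

/-- lim_{λ→+∞} sup_{f ∈ S_α} | μ_f(|x| > λ) / T_f(λ) − 1 | = 0, where μ_f is a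
probability measure on ℝ whose characteristic function is Φ_f. -/
theorem multistable_tail_asymptotics
    (a b : ℝ) (ha : 0 < a) (hab : a < b) (hb : b < 2)
    (α : ℝ → ℝ) (hαm : Measurable α) (hα : ∀ x, α x ∈ Set.Icc a b)
    (μ : (ℝ → ℝ) → Measure ℝ)
    (hμprob : ∀ f, MemSα α f → IsProbabilityMeasure (μ f))
    (hμchar : ∀ f, MemSα α f → ∀ θ : ℝ,
      (∫ x : ℝ, Complex.exp (Complex.I * θ * x) ∂(μ f)) =
        (Real.exp (-∫ x : ℝ, |θ * f x| ^ α x) : ℂ)) :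
    ∀ ε > (0 : ℝ), ∃ Λ : ℝ, ∀ lam ≥ Λ, ∀ f, MemSα α f →
      |(μ f {x : ℝ | lam < |x|}).toReal / Tf α f lam - 1| ≤ ε := by
  intro ε hε
  obtain ⟨Λ, hΛ1, hΛ⟩ := exists_forall_abs_tail_div_sub_one_le ha hab.le hb hε
  refine ⟨Λ, fun lam hlam f hf => ?_⟩
  have hlam1 : 1 ≤ lam := hΛ1.trans hlam
  have := hμprob f hf
  have := isProbabilityMeasure_exponentLaw hαm hf
  have hν : ∀ᵐ γ ∂exponentLaw α f, γ ∈ Set.Icc a b := ae_exponentLaw_mem hαm hα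
  have hchar : ∀ θ : ℝ, ∫ x : ℝ, Complex.exp (Complex.I * θ * x) ∂(μ f)
      = (Real.exp (-∫ γ, |θ| ^ γ ∂exponentLaw α f) : ℂ) := by
    intro θ
    rw [hμchar f hf, integral_exponentLaw hαm hf (by fun_prop : Measurable _).aestronglyMeasurable]
    simp_rw [abs_mul, Real.mul_rpow (abs_nonneg _) (abs_nonneg _), mul_comm]
  have hT : Tf α f lam = ∫ γ, lam ^ (-γ) * Cfun γ ∂exponentLaw α f := by
    rw [integral_exponentLaw hαm hf
      (integrable_rpow_neg_mul_Cfun ha hab.le hb hν hlam1).aestronglyMeasurable, Tf]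
    refine integral_congr_ae (.of_forall fun x => ?_)
    have hlam0 : 0 < lam := by linarith
    dsimp only
    rw [abs_mul, abs_of_pos (inv_pos.2 hlam0), Real.mul_rpow (by positivity) (abs_nonneg _),
      Real.inv_rpow hlam0.le, Real.rpow_neg hlam0.le]
    ring
  rw [hT]
  exact hΛ lam hlam (exponentLaw α f) (μ f) hν hchar
end

section
/- Let f ∈ F_α be not almost everywhere equal to 0 and let μ be a probability measure on ℝ with ∫_ℝ e^{iθx} dμ(x) = Φ_f(θ) for all θ ∈ ℝ. Then μ is absolutely continuous with respect to Lebesgue measure, with density D_f given by D_f(x) = (2π)^{-1} ∫_ℝ e^{−ixθ} Φ_f(θ) dθ; the function D_f is continuous, even and bounded, and moreover ∫_ℝ e^{−iθx} D_f(x) dx = Φ_f(θ) for all θ ∈ ℝ. -/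
open MeasureTheory

/-- Φ_f(θ) = exp(−∫_ℝ |θ f(x)|^{α(x)} dx). -/
noncomputable def Phi (α f : ℝ → ℝ) (θ : ℝ) : ℝ :=
  Real.exp (-∫ x : ℝ, |θ * f x| ^ α x)

section Auxiliary

open Filter Topology Complex

/-- The Fourier transform of `θ ↦ exp (-b θ²)`. -/
noncomputable def gaussKer (b u : ℝ) : ℝ := Real.sqrt (Real.pi / b) * Real.exp (-u ^ 2 / (4 * b))

lemma gaussKer_nonneg (b u : ℝ) : 0 ≤ gaussKer b u := by unfold gaussKer; positivity

lemma gaussKer_le {b : ℝ} (hb : 0 < b) (u : ℝ) : gaussKer b u ≤ Real.sqrt (Real.pi / b) := by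
  refine mul_le_of_le_one_right (Real.sqrt_nonneg _) (Real.exp_le_one_iff.2 ?_)
  exact div_nonpos_of_nonpos_of_nonneg (by simpa using sq_nonneg u) (by positivity)

lemma continuous_gaussKer (b : ℝ) : Continuous (gaussKer b) := by unfold gaussKer; fun_prop

lemma lintegral_gaussKer {b : ℝ} (hb : 0 < b) :
    ∫⁻ u, ENNReal.ofReal (gaussKer b u) = ENNReal.ofReal (2 * Real.pi) := by
  have h4 : ∀ u : ℝ, -u ^ 2 / (4 * b) = -(4 * b)⁻¹ * u ^ 2 := fun u => by field_simp
  have hb4 : 0 < (4 * b)⁻¹ := by positivity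
  rw [← ofReal_integral_eq_lintegral_ofReal _ (ae_of_all _ (gaussKer_nonneg b))]
  · simp only [gaussKer, h4]
    rw [integral_const_mul, integral_gaussian, ← Real.sqrt_mul (by positivity)]
    congr 1
    rw [Real.sqrt_eq_iff_mul_self_eq (by positivity) (by positivity)]
    field_simp
    norm_num
  · change Integrable fun u => gaussKer b u
    simp only [gaussKer, h4]
    exact (integrable_exp_neg_mul_sq hb4).const_mul _

lemma integral_cexp_mul_gaussian {b : ℝ} (hb : 0 < b) (u : ℝ) :
    ∫ θ : ℝ, cexp (I * u * θ) * cexp (-b * θ ^ 2) = gaussKer b u := by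
  rw [fourierIntegral_gaussian (by simpa using hb)]
  rw [gaussKer, Real.sqrt_eq_rpow, ofReal_mul, ofReal_cpow (by positivity)]
  push_cast
  rfl

lemma integrable_exp_neg_mul_abs_rpow {a c : ℝ} (ha : 0 < a) (hc : 0 < c) :
    Integrable fun θ : ℝ => Real.exp (-c * |θ| ^ a) := by
  have h : IntegrableOn (fun θ : ℝ => Real.exp (-c * |θ| ^ a)) (Set.Ioi 0) := by
    have := integrableOn_rpow_mul_exp_neg_mul_rpow (s := 0) (by norm_num) ha hc
    refine this.congr_fun (fun x hx => ?_) measurableSet_Ioi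
    simp [abs_of_pos (Set.mem_Ioi.1 hx)]
  rw [← integrableOn_univ, ← @Set.Iio_union_Ici _ _ (0 : ℝ), integrableOn_union,
    integrableOn_Ici_iff_integrableOn_Ioi]
  refine ⟨?_, h⟩
  have := IntegrableOn.comp_neg_Iio (c := (0 : ℝ)) (f := fun θ : ℝ => Real.exp (-c * |θ| ^ a))
    (by simpa using h)
  simpa using this

lemma integral_charFun_mul_gaussian (μ : Measure ℝ) [IsFiniteMeasure μ] {b : ℝ} (hb : 0 < b) (x : ℝ) :
    ∫ θ : ℝ, cexp (-(I * x * θ)) * charFun μ θ * cexp (-b * θ ^ 2) =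
      ((∫ y, gaussKer b (y - x) ∂μ : ℝ) : ℂ) := by
  have hg : Integrable fun θ : ℝ => cexp (-b * (θ : ℂ) ^ 2) :=
    integrable_cexp_neg_mul_sq (by simpa using hb)
  rw [← integral_complex_ofReal]
  simp_rw [← integral_cexp_mul_gaussian hb]
  rw [← integral_integral_swap]
  · refine integral_congr_ae (ae_of_all _ fun θ => ?_)
    simp only [charFun_apply_real]
    rw [mul_right_comm, ← integral_const_mul]
    refine integral_congr_ae (ae_of_all _ fun y => ?_)
    simp only
    rw [mul_right_comm, ← Complex.exp_add]
    congr 2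
    push_cast; ring
  · have h1 : Integrable (fun p : ℝ × ℝ => cexp (-b * (p.1 : ℂ) ^ 2)) (volume.prod μ) := by
      simpa using hg.mul_prod (integrable_const (μ := μ) (1 : ℂ))
    refine h1.mono (by fun_prop) (ae_of_all _ fun p => ?_)
    have h2 : ‖cexp (I * (p.2 - x : ℝ) * p.1)‖ = 1 := by
      rw [mul_assoc, mul_comm I, ← ofReal_mul, norm_exp_ofReal_mul_I]
    simp only [Function.uncurry, norm_mul, h2, one_mul, le_refl]

/-- The unnormalised density attached to the characteristic function of `μ`. -/
noncomputable def charFunInv (μ : Measure ℝ) (x : ℝ) : ℂ :=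
  ∫ θ : ℝ, cexp (-(I * x * θ)) * charFun μ θ

lemma norm_cexp_neg_I_mul (x θ : ℝ) : ‖cexp (-(I * x * θ))‖ = 1 := by
  rw [mul_assoc, mul_comm I, ← ofReal_mul, ← neg_mul, ← ofReal_neg, norm_exp_ofReal_mul_I]

lemma norm_charFunInv_le (μ : Measure ℝ) (x : ℝ) : ‖charFunInv μ x‖ ≤ ∫ θ, ‖charFun μ θ‖ := by
  refine (norm_integral_le_integral_norm _).trans_eq ?_
  simp [norm_cexp_neg_I_mul]

lemma continuous_charFunInv {μ : Measure ℝ} (h : Integrable (charFun μ)) : Continuous (charFunInv μ) := by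
  refine continuous_of_dominated (bound := fun θ => ‖charFun μ θ‖) (fun x => ?_)
    (fun x => ae_of_all _ fun θ => ?_) h.norm (ae_of_all _ fun θ => by fun_prop)
  · exact (by fun_prop : Continuous fun θ : ℝ => cexp (-(I * x * θ))).aestronglyMeasurable.mul
      h.aestronglyMeasurable
  · simp [norm_cexp_neg_I_mul]

variable {μ : Measure ℝ} [IsFiniteMeasure μ]

lemma tendsto_integral_gaussKer (h : Integrable (charFun μ)) (x : ℝ) :
    Tendsto (fun n : ℕ => ((∫ y, gaussKer (1 / ((n : ℝ) + 1)) (y - x) ∂μ : ℝ) : ℂ)) atTop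
      (𝓝 (charFunInv μ x)) := by
  simp_rw [← fun n : ℕ => integral_charFun_mul_gaussian μ (b := 1 / ((n : ℝ) + 1))
    (by positivity) x]
  refine tendsto_integral_of_dominated_convergence (fun θ => ‖charFun μ θ‖) (fun n => ?_) h.norm
    (fun n => ae_of_all _ fun θ => ?_) (ae_of_all _ fun θ => ?_)
  · have := h.aestronglyMeasurable
    fun_prop
  · rw [norm_mul, norm_mul, norm_cexp_neg_I_mul, one_mul, norm_cexp_neg_mul_sq]
    refine mul_le_of_le_one_right (norm_nonneg _) (Real.exp_le_one_iff.2 ?_)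
    rw [ofReal_re, neg_mul, neg_nonpos]
    positivity
  · have h0 : Tendsto (fun n : ℕ => ((1 / ((n : ℝ) + 1) : ℝ) : ℂ)) atTop (𝓝 ((0 : ℝ) : ℂ)) :=
      (continuous_ofReal.tendsto 0).comp tendsto_one_div_add_atTop_nhds_zero_nat
    have hc : Continuous fun z : ℂ => cexp (-(I * x * θ)) * charFun μ θ * cexp (-z * θ ^ 2) := by
      fun_prop
    simpa [Function.comp_def] using (hc.tendsto _).comp h0

lemma tendsto_integral_gaussKer_re (h : Integrable (charFun μ)) (x : ℝ) :
    Tendsto (fun n : ℕ => ∫ y, gaussKer (1 / ((n : ℝ) + 1)) (y - x) ∂μ) atTop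
      (𝓝 (charFunInv μ x).re) := by
  simpa [Function.comp_def] using (continuous_re.tendsto _).comp (tendsto_integral_gaussKer h x)

lemma charFunInv_re_nonneg (h : Integrable (charFun μ)) (x : ℝ) : 0 ≤ (charFunInv μ x).re :=
  ge_of_tendsto' (tendsto_integral_gaussKer_re h x) fun _ =>
    integral_nonneg fun _ => gaussKer_nonneg _ _

lemma ofReal_charFunInv_re (h : Integrable (charFun μ)) (x : ℝ) :
    ((charFunInv μ x).re : ℂ) = charFunInv μ x := by
  have h1 := (continuous_im.tendsto _).comp (tendsto_integral_gaussKer h x)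
  have h2 : (charFunInv μ x).im = 0 :=
    tendsto_nhds_unique h1 (by simp [Function.comp_def])
  exact Complex.ext (by simp) (by simp [h2])

lemma integrable_gaussKer_sub {b : ℝ} (hb : 0 < b) (x : ℝ) :
    Integrable (fun y => gaussKer b (y - x)) μ := by
  refine (integrable_const (Real.sqrt (Real.pi / b))).mono'
    ((continuous_gaussKer b).comp (by fun_prop)).aestronglyMeasurable (ae_of_all _ fun y => ?_)
  rw [Real.norm_of_nonneg (gaussKer_nonneg _ _)]
  exact gaussKer_le hb _

lemma continuous_integral_gaussKer {b : ℝ} (hb : 0 < b) :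
    Continuous fun x => ∫ y, gaussKer b (y - x) ∂μ := by
  refine continuous_of_dominated (bound := fun _ => Real.sqrt (Real.pi / b)) (fun x => ?_)
    (fun x => ae_of_all _ fun y => ?_) (integrable_const _) (ae_of_all _ fun y => ?_)
  · exact (integrable_gaussKer_sub hb x).aestronglyMeasurable
  · rw [Real.norm_of_nonneg (gaussKer_nonneg _ _)]
    exact gaussKer_le hb _
  · exact (continuous_gaussKer b).comp (by fun_prop)

lemma lintegral_enorm_integral_gaussKer {b : ℝ} (hb : 0 < b) :
    ∫⁻ x, ‖∫ y, gaussKer b (y - x) ∂μ‖ₑ = ENNReal.ofReal (2 * Real.pi) * μ Set.univ := by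
  have h1 : ∀ x, ‖∫ y, gaussKer b (y - x) ∂μ‖ₑ = ∫⁻ y, ENNReal.ofReal (gaussKer b (y - x)) ∂μ := by
    intro x
    rw [Real.enorm_of_nonneg (integral_nonneg fun _ => gaussKer_nonneg _ _),
      ofReal_integral_eq_lintegral_ofReal (integrable_gaussKer_sub hb x)
        (ae_of_all _ fun _ => gaussKer_nonneg _ _)]
  simp_rw [h1]
  have := continuous_gaussKer b
  rw [lintegral_lintegral_swap (by fun_prop)]
  simp_rw [lintegral_sub_left_eq_self (fun u => ENNReal.ofReal (gaussKer b u)),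
    lintegral_gaussKer hb]
  simp

lemma integrable_charFunInv_re (h : Integrable (charFun μ)) :
    Integrable fun x => (charFunInv μ x).re := by
  refine integrable_of_tendsto (ae_of_all _ (tendsto_integral_gaussKer_re h)) (fun n => ?_) ?_
  · exact (continuous_integral_gaussKer (by positivity)).aestronglyMeasurable
  · simp_rw [fun n : ℕ => lintegral_enorm_integral_gaussKer (μ := μ) (b := 1 / ((n : ℝ) + 1))
      (by positivity)]
    rw [liminf_const]
    exact ENNReal.mul_ne_top ENNReal.ofReal_ne_top (measure_ne_top _ _)

open FourierTransform in
lemma integral_cexp_mul_charFunInv (h : Integrable (charFun μ)) (θ : ℝ) :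
    (2 * Real.pi : ℂ)⁻¹ * ∫ x : ℝ, cexp (θ * x * I) * charFunInv μ x = charFun μ θ := by
  have hF : 𝓕 (charFun μ) = fun w => charFunInv μ (2 * Real.pi * w) := by
    ext w
    rw [Real.fourier_real_eq_integral_exp_smul, charFunInv]
    refine integral_congr_ae (ae_of_all _ fun v => ?_)
    simp only [smul_eq_mul]
    congr 2
    push_cast; ring
  have hK : Integrable (charFunInv μ) :=
    (integrable_charFunInv_re h).ofReal.congr (ae_of_all _ (ofReal_charFunInv_re h))
  have hFi : Integrable (𝓕 (charFun μ)) := by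
    rw [hF]
    exact (integrable_comp_mul_left_iff _ (by positivity)).2 hK
  have := congrFun (continuous_charFun.fourierInv_fourier_eq h hFi) θ
  rw [← this, Real.fourierInv_eq', hF]
  have h3 := Measure.integral_comp_mul_left (fun x : ℝ => cexp (θ * x * I) * charFunInv μ x)
    (2 * Real.pi)
  rw [abs_of_pos (by positivity), real_smul] at h3
  push_cast at h3
  rw [← h3]
  refine integral_congr_ae (ae_of_all _ fun v => ?_)
  simp only [smul_eq_mul]
  congr 2
  simp
  ring

lemma eq_withDensity_charFunInv (h : Integrable (charFun μ)) :
    μ = volume.withDensity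
      (fun x => ENNReal.ofReal ((2 * Real.pi)⁻¹ * (charFunInv μ x).re)) := by
  have hi := (integrable_charFunInv_re h).const_mul (2 * Real.pi)⁻¹
  have := isFiniteMeasure_withDensity_ofReal hi.2
  refine Measure.ext_of_charFun (funext fun θ => ?_)
  have hm : Measurable fun x => (2 * Real.pi)⁻¹ * (charFunInv μ x).re := by
    have := continuous_charFunInv h
    fun_prop
  rw [charFun_apply_real (μ := volume.withDensity _), integral_withDensity_eq_integral_toReal_smul
    hm.ennreal_ofReal (ae_of_all _ fun _ => ENNReal.ofReal_lt_top),
    ← integral_cexp_mul_charFunInv h, ← integral_const_mul]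
  refine integral_congr_ae (ae_of_all _ fun x => ?_)
  simp only
  rw [ENNReal.toReal_ofReal (mul_nonneg (by positivity) (charFunInv_re_nonneg h x)), real_smul]
  push_cast
  rw [ofReal_charFunInv_re h]
  ring

lemma integral_abs_rpow_pos {α f : ℝ → ℝ} (hfi : Integrable (fun x => |f x| ^ α x))
    (hα : ∀ x, 0 < α x) (hf0 : ¬ (f =ᵐ[volume] 0)) : 0 < ∫ x, |f x| ^ α x := by
  have h0 : 0 ≤ fun x => |f x| ^ α x := fun x => by positivity
  refine (integral_nonneg h0).lt_of_ne fun h => hf0 ?_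
  filter_upwards [(integral_eq_zero_iff_of_nonneg h0 hfi).1 h.symm] with x hx
  simpa using ((Real.rpow_eq_zero (abs_nonneg _) (hα x).ne').1 hx)

lemma integrable_abs_mul_rpow {a b : ℝ} {α f : ℝ → ℝ} (hαm : Measurable α)
    (hα : ∀ x, α x ∈ Set.Icc a b) (hfm : Measurable f)
    (hfi : Integrable (fun x => |f x| ^ α x)) {θ : ℝ} (hθ : 1 ≤ |θ|) :
    Integrable (fun x => |θ * f x| ^ α x) := by
  refine (hfi.const_mul (|θ| ^ b)).mono'
    (Measurable.pow (by fun_prop) hαm).aestronglyMeasurable (ae_of_all _ fun x => ?_)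
  rw [Real.norm_of_nonneg (by positivity), abs_mul,
    Real.mul_rpow (abs_nonneg _) (abs_nonneg _)]
  gcongr
  exact (hα x).2

lemma Phi_le_exp {a b : ℝ} {α f : ℝ → ℝ} (hαm : Measurable α)
    (hα : ∀ x, α x ∈ Set.Icc a b) (hfm : Measurable f)
    (hfi : Integrable (fun x => |f x| ^ α x)) {θ : ℝ} (hθ : 1 ≤ |θ|) :
    Phi α f θ ≤ Real.exp (-(∫ x, |f x| ^ α x) * |θ| ^ a) := by
  rw [Phi, Real.exp_le_exp, neg_mul, neg_le_neg_iff, ← integral_mul_const]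
  refine integral_mono (hfi.mul_const _) (integrable_abs_mul_rpow hαm hα hfm hfi hθ) fun x => ?_
  simp only
  rw [abs_mul, Real.mul_rpow (abs_nonneg _) (abs_nonneg _), mul_comm]
  gcongr
  exact (hα x).1

lemma integrable_charFun_of_eq_Phi {a b : ℝ} {α f : ℝ → ℝ} (ha : 0 < a) (hαm : Measurable α)
    (hα : ∀ x, α x ∈ Set.Icc a b) (hfm : Measurable f)
    (hfi : Integrable (fun x => |f x| ^ α x)) (hf0 : ¬ (f =ᵐ[volume] 0))
    (hchar : ∀ θ, charFun μ θ = (Phi α f θ : ℂ)) : Integrable (charFun μ) := by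
  have hc := integral_abs_rpow_pos hfi (fun x => ha.trans_le (hα x).1) hf0
  have hone : Integrable (Set.indicator (Set.Icc (-1 : ℝ) 1) fun _ => (1 : ℝ)) :=
    (integrable_indicator_iff measurableSet_Icc).2 (by simp)
  refine ((integrable_exp_neg_mul_abs_rpow ha hc).add hone).mono'
    continuous_charFun.aestronglyMeasurable (ae_of_all _ fun θ => ?_)
  have hpos : 0 ≤ Phi α f θ := (Real.exp_pos _).le
  rw [hchar, norm_real, Real.norm_of_nonneg hpos, Pi.add_apply]
  rcases le_total |θ| 1 with h | h
  · rw [Set.indicator_of_mem (Set.mem_Icc.2 (abs_le.1 h))]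
    have h1 : Phi α f θ ≤ 1 :=
      Real.exp_le_one_iff.2 (neg_nonpos.2 (integral_nonneg fun x => by positivity))
    exact h1.trans (le_add_of_nonneg_left (Real.exp_pos _).le)
  · exact (Phi_le_exp hαm hα hfm hfi h).trans
      (le_add_of_nonneg_right (Set.indicator_nonneg (fun _ _ => zero_le_one) _))

end Auxiliary

/-- if μ is a probability measure on ℝ whose characteristic function is Φ_f
(with f ∈ F_α not a.e. 0), then μ is absolutely continuous w.r.t. Lebesgue measure with
density D_f(x) = (2π)⁻¹ ∫ e^{−ixθ} Φ_f(θ) dθ, and D_f is continuous, even and bounded;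
moreover ∫ e^{−iθx} D_f(x) dx = Φ_f(θ) for all θ. -/
theorem density_of_multistable
    (a b : ℝ) (ha : 0 < a) (hab : a < b) (hb : b < 2)
    (α : ℝ → ℝ) (hαm : Measurable α) (hα : ∀ x, α x ∈ Set.Icc a b)
    (f : ℝ → ℝ) (hfm : Measurable f) (hfi : Integrable (fun x => |f x| ^ α x))
    (hf0 : ¬ (f =ᵐ[volume] 0))
    (μ : Measure ℝ) (hμprob : IsProbabilityMeasure μ)
    (hμchar : ∀ θ : ℝ,
      (∫ x : ℝ, Complex.exp (Complex.I * θ * x) ∂μ) = (Phi α f θ : ℂ)) :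
    ∃ D : ℝ → ℝ,
      (∀ x : ℝ, (D x : ℂ) =
        (2 * Real.pi)⁻¹ * ∫ θ : ℝ, Complex.exp (-(Complex.I * x * θ)) * (Phi α f θ : ℂ)) ∧
      μ = volume.withDensity (fun x => ENNReal.ofReal (D x)) ∧
      Continuous D ∧
      (∀ x : ℝ, D (-x) = D x) ∧
      (∃ M : ℝ, ∀ x : ℝ, |D x| ≤ M) ∧
      (∀ θ : ℝ, (∫ x : ℝ, Complex.exp (-(Complex.I * θ * x)) * (D x : ℂ)) = (Phi α f θ : ℂ)) := by
  have hchar : ∀ θ, charFun μ θ = (Phi α f θ : ℂ) := fun θ => by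
    rw [charFun_apply_real, ← hμchar]
    refine integral_congr_ae (ae_of_all _ fun x => ?_)
    simp only
    congr 1
    ring
  have hint : Integrable (charFun μ) := integrable_charFun_of_eq_Phi ha hαm hα hfm hfi hf0 hchar
  have hPhi : ∀ θ, Phi α f (-θ) = Phi α f θ := fun θ => by simp [Phi]
  have hD : ∀ x, (((2 * Real.pi)⁻¹ * (charFunInv μ x).re : ℝ) : ℂ) =
      (2 * Real.pi)⁻¹ * charFunInv μ x := fun x => by
    push_cast
    rw [ofReal_charFunInv_re hint]
  refine ⟨fun x => (2 * Real.pi)⁻¹ * (charFunInv μ x).re, fun x => ?_,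
    eq_withDensity_charFunInv hint, ?_, fun x => ?_,
    ⟨(2 * Real.pi)⁻¹ * ∫ θ, ‖charFun μ θ‖, fun x => ?_⟩, fun θ => ?_⟩
  · simpa only [charFunInv, hchar] using hD x
  · have := continuous_charFunInv hint
    fun_prop
  · simp only
    congr 2
    simp only [charFunInv]
    rw [← integral_neg_eq_self]
    simp [hchar, hPhi]
  · rw [abs_mul, abs_of_pos (by positivity : 0 < (2 * Real.pi)⁻¹)]
    gcongr
    exact (Complex.abs_re_le_norm _).trans (norm_charFunInv_le μ x)
  · rw [← hPhi, ← hchar, ← integral_cexp_mul_charFunInv hint, ← integral_const_mul]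
    refine integral_congr_ae (ae_of_all _ fun x => ?_)
    simp only [hD]
    rw [mul_left_comm]
    congr 2
    · push_cast
      rfl
    · congr 1
      push_cast
      ring
end
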